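/- arXiv:2206.05230 — 3 statements merged into one kernel-verified Lean document; each statement's English description precedes it below -/
import Mathlib

section
/- Let m, n, l ∈ ℕ with m ≤ n and n−m ≤ l ≤ n+m, and let α, β ∈ ℝ with α, β > −1 and with α−β ∉ ℤ and α+β ∉ ℤ. Then ∫_{−1}^{1} P_m^{(α,β)}(x)·P_n^{(α,β)}(x)·P_l^{(α,β)}(x)·(1−x)^α(1+x)^β dx = 𝖺^{α,β}_{l+m−n,n,m} · h_l, where h_l = 2^{α+β+1}Γ(l+α+1)Γ(l+β+1)/((2l+α+β+1)Γ(l+α+β+1)l!) and 𝖺^{α,β}_{k,n,m} is the Rahman linearization coefficient. -/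
open MeasureTheory

/-- Pochhammer symbol `(a)_j` for real `a` and natural `j`. -/
noncomputable def poch (a : ℝ) (j : ℕ) : ℝ := (ascPochhammer ℝ j).eval a

/-- Pochhammer symbol `(a)_j` for integer index, with the convention
`(a)_{-j} = 1/((a-1)(a-2)⋯(a-j))` for `j ≥ 1`. -/
noncomputable def pochZ (a : ℝ) (j : ℤ) : ℝ :=
  if 0 ≤ j then poch a j.toNat
  else (∏ i ∈ Finset.range (-j).toNat, (a - (i + 1)))⁻¹

/-- Factorial of an integer: `j!` for `j ≥ 0` and `0` for `j < 0`
(encoding `1/(negative integer)! = 0` via Lean's division by zero). -/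
noncomputable def ifact (j : ℤ) : ℝ := if 0 ≤ j then (j.toNat.factorial : ℝ) else 0

/-- Generalized hypergeometric sum `ᵣF_s(a; b; z)` (intended for terminating series,
where all terms beyond the termination index vanish). -/
noncomputable def hypSum (a b : List ℝ) (z : ℝ) : ℝ :=
  ∑' j : ℕ, ((a.map fun t => poch t j).prod /
    ((b.map fun t => poch t j).prod * (j.factorial : ℝ))) * z ^ j

/-- Jacobi polynomial `P_n^{(α,β)}(x)`. -/
noncomputable def jacobiP (α β : ℝ) (n : ℕ) (x : ℝ) : ℝ :=
  poch (α + 1) n / n.factorial *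
    ∑ j ∈ Finset.range (n + 1),
      poch (-(n : ℝ)) j * poch ((n : ℝ) + α + β + 1) j /
        (poch (α + 1) j * j.factorial) * ((1 - x) / 2) ^ j

/-- The (corrected) Rahman linearization coefficient `𝖺^{α,β}_{k,n,m}`. -/
noncomputable def aRah (α β : ℝ) (k n m : ℤ) : ℝ :=
  (pochZ (α + 1) n * pochZ (β + 1) n * pochZ (α + β + 1) (2 * n - 2 * m) *
      pochZ (α + β + 1) (2 * m) * (α + β + 1 + 2 * (n : ℝ) - 2 * m + 2 * k)) /
    (ifact m * pochZ (α + β + 1) m * pochZ (α + 1) (n - m) * pochZ (β + 1) (n - m) *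
      pochZ (α + β + 2) (2 * n) * (α + β + 1)) *
  ((pochZ ((n : ℝ) - m + 1) k * pochZ (α + β + 2 * (n : ℝ) - 2 * m + 1) k *
      pochZ (2 * α + 2 * β + 2 * (n : ℝ) + 2) k * pochZ (-2 * (m : ℝ)) k *
      pochZ (α - β) k) /
    (ifact k * pochZ (2 * β + 2 * (n : ℝ) - 2 * m + 2) k *
      pochZ (α + (n : ℝ) - m + 1) k * pochZ (α + β + 2 * (n : ℝ) + 2) k *
      pochZ (-α - β - 2 * (m : ℝ)) k)) *
  hypSum
    [β + (n : ℝ) - m + 1 / 2, (β + (n : ℝ) - m + 5 / 2) / 2, β + 1 / 2, β + (n : ℝ) + 1,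
      -α - (m : ℝ), (α + β + (k : ℝ) + 1) / 2 + (n : ℝ) - m,
      (α + β + (k : ℝ) + 2) / 2 + (n : ℝ) - m, -(k : ℝ) / 2, (1 - (k : ℝ)) / 2]
    [(β + (n : ℝ) - m + 1 / 2) / 2, (n : ℝ) - m + 1, 1 / 2 - (m : ℝ),
      α + β + (n : ℝ) + 3 / 2, (β - α - (k : ℝ) + 1) / 2, (β - α - (k : ℝ) + 2) / 2,
      ((k : ℝ) + 2) / 2 + β + (n : ℝ) - m, ((k : ℝ) + 3) / 2 + β + (n : ℝ) - m]
    1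


theorem poch_zero (a : ℝ) : poch a 0 = 1 := by simp [poch]

theorem poch_succ (a : ℝ) (j : ℕ) : poch a (j + 1) = poch a j * (a + j) := by
  simp [poch, ascPochhammer_succ_right]

theorem poch_succ_left (a : ℝ) (j : ℕ) : poch a (j + 1) = a * poch (a + 1) j := by
  simp [poch, ascPochhammer_succ_left]

theorem poch_add (a : ℝ) (i j : ℕ) : poch a (i + j) = poch a i * poch (a + i) j := by
  induction j with
  | zero => simp [poch_zero]
  | succ j ih => rw [← add_assoc, poch_succ, ih, poch_succ]; push_cast; ring

theorem poch_mul_shift (a : ℝ) (j : ℕ) : poch a j * (a + j) = a * poch (a + 1) j := by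
  rw [← poch_succ, poch_succ_left]

theorem poch_ne_zero {a : ℝ} (h : ∀ i : ℕ, a + i ≠ 0) (j : ℕ) : poch a j ≠ 0 := by
  induction j with
  | zero => simp [poch_zero]
  | succ j ih => rw [poch_succ]; exact mul_ne_zero ih (h j)

theorem poch_neg_nat_eq_zero {n j : ℕ} (h : n < j) : poch (-(n : ℝ)) j = 0 := by
  obtain ⟨i, rfl⟩ := Nat.exists_eq_add_of_lt h
  rw [add_assoc, add_comm i 1, ← add_assoc, poch_add, poch_succ]
  simp

theorem poch_two_mul (a : ℝ) (j : ℕ) :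
    poch a (2 * j) = 4 ^ j * (poch (a / 2) j * poch ((a + 1) / 2) j) := by
  induction j with
  | zero => simp [poch_zero]
  | succ j ih =>
    rw [show 2 * (j + 1) = 2 * j + 1 + 1 by ring, poch_succ, poch_succ, ih, poch_succ, poch_succ]
    push_cast; ring

theorem poch_neg_self (n : ℕ) : poch (-(n : ℝ)) n = (-1) ^ n * n.factorial := by
  induction n with
  | zero => simp [poch_zero]
  | succ n ih =>
    rw [poch_succ_left, Nat.factorial_succ,
      show (-((n + 1 : ℕ) : ℝ) + 1) = -(n : ℝ) by push_cast; ring, ih]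
    push_cast; ring

theorem Gamma_nat_add (a : ℝ) (h : ∀ i : ℕ, a + i ≠ 0) (j : ℕ) :
    Real.Gamma (j + a) = poch a j * Real.Gamma a := by
  induction j with
  | zero => simp [poch_zero]
  | succ j ih =>
    rw [poch_succ, show ((j + 1 : ℕ) : ℝ) + a = (j + a) + 1 by push_cast; ring,
      Real.Gamma_add_one (by rw [add_comm]; exact h j), ih]
    ring

/-- Coefficients of the hypergeometric polynomial `₂F₁(-n, n + s; c; X)`. -/
noncomputable def jacCoeff (c s : ℝ) (n j : ℕ) : ℝ :=
  poch (-(n : ℝ)) j * poch (n + s) j / (poch c j * j.factorial)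

/-- The hypergeometric polynomial `₂F₁(-n, n + s; c; X)`. -/
noncomputable def jacPoly (c s : ℝ) (n : ℕ) : Polynomial ℝ :=
  ∑ j ∈ Finset.range (n + 1), Polynomial.monomial j (jacCoeff c s n j)

section Jacobi

open Polynomial

variable {c s : ℝ}

theorem jacCoeff_zero (n : ℕ) : jacCoeff c s n 0 = 1 := by simp [jacCoeff, poch_zero]

theorem jacCoeff_eq_zero {n j : ℕ} (h : n < j) : jacCoeff c s n j = 0 := by
  simp [jacCoeff, poch_neg_nat_eq_zero h]

theorem coeff_jacPoly (n j : ℕ) : (jacPoly c s n).coeff j = jacCoeff c s n j := by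
  simp only [jacPoly, finsetSum_coeff, coeff_monomial]
  rw [Finset.sum_ite_eq' (Finset.range (n + 1)) j]
  split_ifs with h
  · rfl
  · rw [jacCoeff_eq_zero (by simpa using h)]

theorem natDegree_jacPoly_le (n : ℕ) : (jacPoly c s n).natDegree ≤ n := by
  rw [natDegree_le_iff_coeff_eq_zero]
  intro j hj
  rw [coeff_jacPoly, jacCoeff_eq_zero hj]

theorem jacCoeff_succ_right (hc : ∀ j : ℕ, c + j ≠ 0) (n j : ℕ) :
    jacCoeff c s n (j + 1) * ((c + j) * (j + 1)) = jacCoeff c s n j * ((j - n) * (n + s + j)) := by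
  have h1 := poch_ne_zero hc j
  have h2 := hc j
  have h3 : (j.factorial : ℝ) ≠ 0 := by positivity
  have h4 : (j : ℝ) + 1 ≠ 0 := by positivity
  simp only [jacCoeff, poch_succ, Nat.factorial_succ]
  push_cast
  field_simp
  ring

theorem jacCoeff_succ_succ (hc : ∀ j : ℕ, c + j ≠ 0) (n j : ℕ) :
    jacCoeff c s (n + 1) (j + 1) * ((n + s) * ((c + j) * (j + 1))) =
      -(jacCoeff c s n j * ((n + 1) * (n + s + j) * (n + s + j + 1))) := by
  have h1 := poch_ne_zero hc j
  have h2 := hc j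
  have h3 : (j.factorial : ℝ) ≠ 0 := by positivity
  have h4 : (j : ℝ) + 1 ≠ 0 := by positivity
  have h6 : poch (n + s + 1) (j + 1) * (n + s) = poch (n + s) j * (n + s + j) * (n + s + j + 1) :=
      by
    rw [mul_comm, ← poch_succ_left, poch_succ, poch_succ]; push_cast; ring
  have h7 : poch (-((n + 1 : ℕ) : ℝ)) (j + 1) = -(n + 1) * poch (-(n : ℝ)) j := by
    rw [poch_succ_left]; push_cast; ring_nf
  have h8 : (((n + 1 : ℕ) : ℝ) + s) = n + s + 1 := by push_cast; ring
  simp only [jacCoeff]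
  rw [h7, h8, poch_succ c, Nat.factorial_succ]
  push_cast
  field_simp
  linear_combination (-poch (-(n : ℝ)) j) * h6

theorem jacCoeff_pred_succ (hc : ∀ j : ℕ, c + j ≠ 0) (n j : ℕ) :
    n * jacCoeff c s (n - 1) (j + 1) * ((c + j) * (j + 1)) =
      -(jacCoeff c s n j * ((j - n) * (j - n + 1) * (n - 1 + s))) := by
  rcases n with _ | n
  · rcases j with _ | j
    · simp
    · simp [jacCoeff_eq_zero]
  have h1 := poch_ne_zero hc j
  have h2 := hc j
  have h3 : (j.factorial : ℝ) ≠ 0 := by positivity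
  have h4 : (j : ℝ) + 1 ≠ 0 := by positivity
  have h7 : (n + 1 : ℝ) * poch (-(n : ℝ)) (j + 1) =
      - poch (-((n + 1 : ℕ) : ℝ)) j * ((j - (n + 1)) * (j - (n + 1) + 1)) := by
    have := poch_succ_left (-((n + 1 : ℕ) : ℝ)) (j + 1)
    rw [poch_succ, poch_succ, show -((n + 1 : ℕ) : ℝ) + 1 = -(n : ℝ) by push_cast; ring] at this
    push_cast at this ⊢
    linear_combination this
  have h8 : poch (n + s) (j + 1) = (n + s) * poch (((n + 1 : ℕ) : ℝ) + s) j := by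
    rw [poch_succ_left]; push_cast; ring_nf
  simp only [jacCoeff, Nat.add_sub_cancel]
  rw [h8, poch_succ c, Nat.factorial_succ]
  push_cast at h7 ⊢
  field_simp
  linear_combination ((n + s) * poch (n + 1 + s) j) * h7

theorem jacPoly_ode (hc : ∀ j : ℕ, c + j ≠ 0) (n : ℕ) :
    X * (1 - X) * derivative (derivative (jacPoly c s n)) +
      (C c - C (s + 1) * X) * derivative (jacPoly c s n) =
      - (C (n * (n + s)) * jacPoly c s n) := by
  ext j
  have h := jacCoeff_succ_right (s := s) hc n j
  rcases j with _ | j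
  · simp [mul_sub, sub_mul, mul_assoc, coeff_derivative, coeff_jacPoly, jacCoeff_zero] at h ⊢
    linear_combination h
  · rw [show X * (1 - X) * derivative (derivative (jacPoly c s n)) +
      (C c - C (s + 1) * X) * derivative (jacPoly c s n) =
        X * derivative (derivative (jacPoly c s n)) -
        X * (X * derivative (derivative (jacPoly c s n))) +
        C c * derivative (jacPoly c s n) - C (s + 1) * (X * derivative (jacPoly c s n)) by ring]
    rcases j with _ | j
    · simp [coeff_X_mul, coeff_derivative, coeff_jacPoly, -map_add, -map_mul, -map_natCast] at h ⊢
      linear_combination h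
    · simp [coeff_X_mul, coeff_derivative, coeff_jacPoly, -map_add, -map_mul, -map_natCast] at h ⊢
      linear_combination h

theorem add_intCast_ne_zero (hs : ∀ z : ℤ, s ≠ z) (z : ℤ) : s + z ≠ 0 := fun h =>
  hs (-z) (by push_cast; linarith)

/-- Coefficient of `F_{n+1}` in the expansion of `X F_n`. -/
noncomputable def recA (c s n : ℝ) : ℝ := -((n + s) * (n + c)) / ((2 * n + s) * (2 * n + s + 1))

/-- Coefficient of `F_{n-1}` in the expansion of `X F_n`. -/
noncomputable def recC (c s n : ℝ) : ℝ := -(n * (n + s - c)) / ((2 * n + s) * (2 * n + s - 1))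

/-- Coefficient of `F_n'` in the expansion of `F_n` in derivatives. -/
noncomputable def derB (c s n : ℝ) : ℝ := -(2 * c - s - 1) / ((2 * n + s + 1) * (2 * n + s - 1))

theorem denominators_ne_zero (hs : ∀ z : ℤ, s ≠ z) (n : ℕ) :
    (n : ℝ) + s ≠ 0 ∧ (n : ℝ) * 2 + s ≠ 0 ∧ (n : ℝ) * 2 + s + 1 ≠ 0 ∧ (n : ℝ) * 2 + s - 1 ≠ 0 ∧
      (n : ℝ) + s - 1 ≠ 0 := by
  refine ⟨?_, ?_, ?_, ?_, ?_⟩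
  · have := add_intCast_ne_zero hs n; push_cast at this; intro h; apply this; linarith
  · have := add_intCast_ne_zero hs (2 * n); push_cast at this; intro h; apply this; linarith
  · have := add_intCast_ne_zero hs (2 * n + 1); push_cast at this; intro h; apply this; linarith
  · have := add_intCast_ne_zero hs (2 * n - 1); push_cast at this; intro h; apply this; linarith
  · have := add_intCast_ne_zero hs (n - 1); push_cast at this; intro h; apply this; linarith

theorem jacPoly_X_mul (hc : ∀ j : ℕ, c + j ≠ 0) (hs : ∀ z : ℤ, s ≠ z) (n : ℕ) :
    X * jacPoly c s n = C (recA c s n) * jacPoly c s (n + 1) +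
      C (-recA c s n - recC c s n) * jacPoly c s n + C (recC c s n) * jacPoly c s (n - 1) := by
  ext j
  rcases j with _ | j
  · simp [mul_coeff_zero, coeff_jacPoly, jacCoeff_zero, -map_sub, -map_neg]
    ring
  obtain ⟨d0, d1, d2, d3, -⟩ := denominators_ne_zero hs n
  have h1 := jacCoeff_succ_right (s := s) hc n j
  have h2 := jacCoeff_succ_succ (s := s) hc n j
  have h3 := jacCoeff_pred_succ (s := s) hc n j
  have hcj := hc j
  have h4 : (j : ℝ) + 1 ≠ 0 := by positivity
  simp only [coeff_X_mul, coeff_add, coeff_C_mul, coeff_jacPoly]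
  set e := jacCoeff c s n j
  have e1 : jacCoeff c s n (j + 1) = e * ((j - n) * (n + s + j)) / ((c + j) * (j + 1)) := by
    rw [eq_div_iff (by positivity)]; exact h1
  have e2 : jacCoeff c s (n + 1) (j + 1) =
      -(e * ((n + 1) * (n + s + j) * (n + s + j + 1))) / ((n + s) * ((c + j) * (j + 1))) := by
    rw [eq_div_iff (by positivity)]; exact h2
  have e3 : n * jacCoeff c s (n - 1) (j + 1) =
      -(e * ((j - n) * (j - n + 1) * (n - 1 + s))) / ((c + j) * (j + 1)) := by
    rw [eq_div_iff (by positivity)]; exact h3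
  have e4 : recC c s n * jacCoeff c s (n - 1) (j + 1) =
      -(n + s - c) / ((2 * n + s) * (2 * n + s - 1)) * (n * jacCoeff c s (n - 1) (j + 1)) := by
    simp only [recC]; ring
  rw [e4, e3, e1, e2]
  simp only [recA, recC]
  field_simp
  ring

theorem jacPoly_eq_derivative (hc : ∀ j : ℕ, c + j ≠ 0) (hs : ∀ z : ℤ, s ≠ z) (n : ℕ) :
    derivative (C (recA c s n / (n + 1)) * jacPoly c s (n + 1) +
      C (derB c s n) * jacPoly c s n + C (-recC c s n / (n + s - 1)) * jacPoly c s (n - 1)) =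
      jacPoly c s n := by
  ext j
  obtain ⟨d0, d1, d2, d3, d4⟩ := denominators_ne_zero hs n
  have h1 := jacCoeff_succ_right (s := s) hc n j
  have h2 := jacCoeff_succ_succ (s := s) hc n j
  have h3 := jacCoeff_pred_succ (s := s) hc n j
  have hcj := hc j
  have h4 : (j : ℝ) + 1 ≠ 0 := by positivity
  have h5 : (n : ℝ) + 1 ≠ 0 := by positivity
  simp only [coeff_derivative, coeff_add, coeff_C_mul, coeff_jacPoly]
  set e := jacCoeff c s n j
  have e1 : jacCoeff c s n (j + 1) = e * ((j - n) * (n + s + j)) / ((c + j) * (j + 1)) := by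
    rw [eq_div_iff (by positivity)]; exact h1
  have e2 : jacCoeff c s (n + 1) (j + 1) =
      -(e * ((n + 1) * (n + s + j) * (n + s + j + 1))) / ((n + s) * ((c + j) * (j + 1))) := by
    rw [eq_div_iff (by positivity)]; exact h2
  have e3 : n * jacCoeff c s (n - 1) (j + 1) =
      -(e * ((j - n) * (j - n + 1) * (n - 1 + s))) / ((c + j) * (j + 1)) := by
    rw [eq_div_iff (by positivity)]; exact h3
  have e4 : -recC c s n / (n + s - 1) * jacCoeff c s (n - 1) (j + 1) =
      (n + s - c) / ((2 * n + s) * (2 * n + s - 1) * (n + s - 1)) *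
        (n * jacCoeff c s (n - 1) (j + 1)) := by
    simp only [recC]
    field_simp
  rw [e4, e3, e1, e2]
  simp only [recA, derB]
  field_simp
  ring

end Jacobi

section Functional

open Polynomial

variable {c s : ℝ} {Λ : ℝ[X] →ₗ[ℝ] ℝ}

/-- A functional that annihilates `(X (1 - X) w g)' / w` for the Jacobi weight `w`. -/
def IsJacobiFunctional (c s : ℝ) (Λ : ℝ[X] →ₗ[ℝ] ℝ) : Prop :=
  ∀ g : ℝ[X], Λ (X * (1 - X) * derivative g + (C c - C (s + 1) * X) * g) = 0

theorem map_C_mul (Λ : ℝ[X] →ₗ[ℝ] ℝ) (a : ℝ) (p : ℝ[X]) : Λ (C a * p) = a * Λ p := by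
  rw [← smul_eq_C_mul, map_smul, smul_eq_mul]

theorem IsJacobiFunctional.X_pow_mul_succ (hΛ : IsJacobiFunctional c s Λ)
    (hc : ∀ j : ℕ, c + j ≠ 0) (n i : ℕ) :
    (n * (n + s) - (i + 1) * (i + 1 + s)) * Λ (X ^ (i + 1) * jacPoly c s n) =
      -((i + 1) * (c + i) * Λ (X ^ i * jacPoly c s n)) := by
  have h := hΛ (X ^ (i + 1) * derivative (jacPoly c s n) -
    C (i + 1 : ℝ) * X ^ i * jacPoly c s n)
  have ho := jacPoly_ode (s := s) hc n
  set F := jacPoly c s n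
  have e : X * (1 - X) * derivative (X ^ (i + 1) * derivative F - C (i + 1 : ℝ) * X ^ i * F) +
      (C c - C (s + 1) * X) * (X ^ (i + 1) * derivative F - C (i + 1 : ℝ) * X ^ i * F) =
      -(C (n * (n + s) - (i + 1) * (i + 1 + s)) * (X ^ (i + 1) * F)) -
        C ((i + 1) * (c + i)) * (X ^ i * F) := by
    rcases i with _ | i
    · simp only [derivative_mul, derivative_sub, derivative_C, derivative_X_pow]
      simp only [C_add, C_mul, C_sub, C_1, map_natCast] at ho ⊢
      simp
      linear_combination X * ho
    · simp only [derivative_mul, derivative_sub, derivative_C, derivative_X_pow]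
      simp only [C_add, C_mul, C_sub, C_1, map_natCast] at ho ⊢
      simp
      linear_combination X ^ (i + 2) * ho
  rw [e, map_sub, map_neg, map_C_mul, map_C_mul] at h
  linear_combination -h

theorem eigenvalue_sub_ne_zero (hs : ∀ z : ℤ, s ≠ z) {n i : ℕ} (h : i ≠ n) :
    (n * (n + s) - i * (i + s) : ℝ) ≠ 0 := by
  have h1 : (n : ℝ) - i ≠ 0 := by
    rw [sub_ne_zero]; exact_mod_cast h.symm
  have h2 := add_intCast_ne_zero hs (n + i)
  push_cast at h2
  rw [show (n * (n + s) - i * (i + s) : ℝ) = (n - i) * (s + (n + i)) by ring]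
  exact mul_ne_zero h1 h2

theorem IsJacobiFunctional.X_pow_mul_eq_zero (hΛ : IsJacobiFunctional c s Λ)
    (hc : ∀ j : ℕ, c + j ≠ 0) (hs : ∀ z : ℤ, s ≠ z) {n : ℕ} {i : ℕ} (h : i < n) :
    Λ (X ^ i * jacPoly c s n) = 0 := by
  induction i with
  | zero =>
    have h' := hΛ (derivative (jacPoly c s n))
    rw [jacPoly_ode hc n, map_neg, map_C_mul, neg_eq_zero] at h'
    have := eigenvalue_sub_ne_zero hs h.ne
    simp only [Nat.cast_zero, zero_mul, sub_zero] at this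
    simpa using (mul_eq_zero.1 h').resolve_left this
  | succ i ih =>
    have h' := hΛ.X_pow_mul_succ hc n i
    rw [ih (by omega), mul_zero, neg_zero] at h'
    have := eigenvalue_sub_ne_zero hs h.ne
    push_cast at this
    exact (mul_eq_zero.1 h').resolve_left this

theorem IsJacobiFunctional.mul_eq_coeff (hΛ : IsJacobiFunctional c s Λ)
    (hc : ∀ j : ℕ, c + j ≠ 0) (hs : ∀ z : ℤ, s ≠ z) {n : ℕ} {p : ℝ[X]} (hp : p.natDegree ≤ n) :
    Λ (p * jacPoly c s n) = p.coeff n * Λ (X ^ n * jacPoly c s n) := by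
  conv_lhs => rw [p.as_sum_range_C_mul_X_pow' (Nat.lt_succ_of_le hp)]
  rw [Finset.sum_mul, map_sum, Finset.sum_range_succ, Finset.sum_eq_zero, zero_add, mul_assoc,
    map_C_mul]
  intro i hi
  rw [mul_assoc, map_C_mul, hΛ.X_pow_mul_eq_zero hc hs (Finset.mem_range.1 hi), mul_zero]

theorem IsJacobiFunctional.X_pow_self (hΛ : IsJacobiFunctional c s Λ)
    (hc : ∀ j : ℕ, c + j ≠ 0) (hs : ∀ z : ℤ, s ≠ z) (n : ℕ) :
    Λ (X ^ n * jacPoly c s n) =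
      (-1) ^ n * (poch (s - c + 1) n * n.factorial / poch (s + 1) (2 * n)) * Λ 1 := by
  induction n with
  | zero => simp [jacPoly, jacCoeff_zero, poch_zero]
  | succ n ih =>
    rw [pow_succ X, mul_assoc, jacPoly_X_mul hc hs, mul_add, mul_add, mul_left_comm,
      mul_left_comm (X ^ n), mul_left_comm (X ^ n), map_add, map_add, map_C_mul, map_C_mul,
      map_C_mul, hΛ.X_pow_mul_eq_zero hc hs (by omega), hΛ.X_pow_mul_eq_zero hc hs (by omega),
      Nat.add_sub_cancel, ih, show 2 * (n + 1) = 2 * n + 1 + 1 by ring, poch_succ, poch_succ,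
      poch_succ, Nat.factorial_succ]
    have h1 : poch (s + 1) (2 * n) ≠ 0 := poch_ne_zero (fun i => by
      have := add_intCast_ne_zero hs (i + 1); push_cast at this; rwa [add_comm (i : ℝ), ←
          add_assoc] at this) _
    have h2 : 2 * n + 1 + s ≠ 0 := by
      have := add_intCast_ne_zero hs (2 * n + 1); push_cast at this; rwa [add_comm]
    have h3 : 2 * n + 2 + s ≠ 0 := by
      have := add_intCast_ne_zero hs (2 * n + 2); push_cast at this; rwa [add_comm]
    simp only [recC]
    push_cast
    rw [show 2 * ((n : ℝ) + 1) + s = 2 * n + 2 + s by ring,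
      show 2 * (n : ℝ) + 2 + s - 1 = 2 * n + 1 + s by ring,
      show s + 1 + 2 * (n : ℝ) = 2 * n + 1 + s by ring,
      show s + 1 + (2 * (n : ℝ) + 1) = 2 * n + 2 + s by ring, pow_succ]
    generalize (2 * (n : ℝ) + 2 + s) = x at *
    generalize (2 * (n : ℝ) + 1 + s) = y at *
    field_simp
    ring

/-- The differential equation with eigenvalue `a`. -/
def JacobiODE (c s a : ℝ) (F : ℝ[X]) : Prop :=
  X * (1 - X) * derivative (derivative F) + (C c - C (s + 1) * X) * derivative F = -(C a * F)

theorem IsJacobiFunctional.mixed (hΛ : IsJacobiFunctional c s Λ) {a b d : ℝ} {F G H : ℝ[X]}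
    (hF : JacobiODE c s a F) (hG : JacobiODE c s b G) (hH : JacobiODE c s d H) :
    2 * Λ (X * (1 - X) * derivative F * derivative G * H) = (a + b - d) * Λ (F * G * H) := by
  have h := hΛ (derivative (F * G) * H - F * G * derivative H)
  rw [show X * (1 - X) * derivative (derivative (F * G) * H - F * G * derivative H) +
      (C c - C (s + 1) * X) * (derivative (F * G) * H - F * G * derivative H) =
      C 2 * (X * (1 - X) * derivative F * derivative G * H) - C (a + b - d) * (F * G * H) by
    unfold JacobiODE at hF hG hH
    simp only [derivative_mul, derivative_sub, derivative_add, C_add, C_sub, C_1] at *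
    rw [show (C 2 : ℝ[X]) = 2 from rfl]
    linear_combination (G * H) * hF + (F * H) * hG - F * G * hH,
    map_sub, map_C_mul, map_C_mul] at h
  linear_combination h

theorem IsJacobiFunctional.test_identity (hΛ : IsJacobiFunctional c s Λ) {a b : ℝ} {F G : ℝ[X]}
    (hF : JacobiODE c s a F) (hG : JacobiODE c s b G) (f : ℝ[X]) :
    let L := X * (1 - X) * derivative (derivative f) + (C c - C (s + 1) * X) * derivative f
    let z := X * (1 - X) * derivative F * derivative G
    Λ (-(z * L) + (C (2 * c - 1) - C (2 * s) * X) * z * derivative f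
      - C ((a + b) / 2) * (F * G * L) - C ((a - b) ^ 2 / 2) * (F * G * f)) = 0 := by
  intro L z
  have h := hΛ (z * derivative f + C ((a + b) / 2) * (F * G * derivative f) +
    C ((a - b) / 2) * ((F * derivative G - G * derivative F) * f))
  rw [← neg_eq_zero, ← map_neg] at h
  rw [← h]
  congr 1
  unfold JacobiODE at hF hG
  obtain ⟨u, rfl⟩ : ∃ u, a = 2 * u := ⟨a / 2, by ring⟩
  obtain ⟨v, rfl⟩ : ∃ v, b = 2 * v := ⟨b / 2, by ring⟩
  rw [show (2 * u - 2 * v) ^ 2 / 2 = 2 * (u - v) ^ 2 by ring,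
    show (2 * u + 2 * v) / 2 = u + v by ring, show (2 * u - 2 * v) / 2 = u - v by ring]
  simp only [derivative_mul, derivative_sub, derivative_add, derivative_C, derivative_X,
    derivative_one, C_add, C_sub, C_mul, C_pow, C_1, L, z] at *
  rw [show (C 2 : ℝ[X]) = 2 from rfl] at *
  linear_combination
    (X * (1 - X) * derivative G * derivative f - (C u - C v) * f * G) * hF +
    (X * (1 - X) * derivative F * derivative f + (C u - C v) * f * F) * hG

end Functional

section LinearizationRecurrence

open Polynomial

variable {c s : ℝ} {Λ : ℝ[X] →ₗ[ℝ] ℝ}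

/-- Numerator of `midCoeff`. -/
noncomputable def midNum (c s m n l : ℝ) : ℝ :=
  -(2 * c - s - 1) * (l * (l + s) * (m * (m + s) + n * (n + s) - l * (l + s) +
        (m * (m + s) + n * (n + s))) - (m * (m + s) - n * (n + s)) ^ 2) +
    ((2 * c - 1) * ((2 * l + s + 1) * (2 * l + s - 1)) - 2 * s * (2 * l * (l + s) + (s - 1) * c)) *
      (m * (m + s) + n * (n + s) - l * (l + s))

/-- Middle coefficient of the three-term recurrence for `Λ (F_m F_n F_l)`. -/
noncomputable def midCoeff (c s m n l : ℝ) : ℝ :=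
  midNum c s m n l / ((2 * l + s + 1) * (2 * l + s - 1))

theorem midCoeff_eq (c m n : ℝ) {s l : ℝ} (h0 : 2 * l + s ≠ 0) (h1 : 2 * l + s + 1 ≠ 0)
    (h2 : 2 * l + s - 1 ≠ 0) :
    derB c s l * (l * (l + s) * (m * (m + s) + n * (n + s) - l * (l + s) +
        (m * (m + s) + n * (n + s))) - (m * (m + s) - n * (n + s)) ^ 2) +
      (2 * c - 1 - 2 * s * (-recA c s l - recC c s l)) *
      (m * (m + s) + n * (n + s) - l * (l + s)) = midCoeff c s m n l := by
  obtain ⟨x, rfl⟩ : ∃ x, s = x - 2 * l := ⟨2 * l + s, by ring⟩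
  simp only [derB, recA, recC, midCoeff, midNum]
  rw [show 2 * l + (x - 2 * l) = x by ring] at *
  field_simp
  ring

theorem IsJacobiFunctional.triple_recurrence (hΛ : IsJacobiFunctional c s Λ)
    (hc : ∀ j : ℕ, c + j ≠ 0) (hs : ∀ z : ℤ, s ≠ z) (m n l : ℕ) :
    recA c s l / (l + 1) *
        -((l + 1 - (n - m)) * (l + 1 + (n - m)) * (l + 1 + n + m + s) * (l + 1 - n - m - s)) *
        Λ (jacPoly c s m * jacPoly c s n * jacPoly c s (l + 1)) +
      midCoeff c s m n l * Λ (jacPoly c s m * jacPoly c s n * jacPoly c s l) +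
      -recC c s l / (l + s - 1) *
        -((l - 1 - n - m) * (l - 1 + (n - m) + s) * (l - 1 - (n - m) + s) *
          (l - 1 + n + m + 2 * s)) *
        Λ (jacPoly c s m * jacPoly c s n * jacPoly c s (l - 1)) = 0 := by
  obtain ⟨d0, d1, d2, d3, d4⟩ := denominators_ne_zero hs l
  have d5 : (l : ℝ) + 1 ≠ 0 := by positivity
  have om : JacobiODE c s (m * (m + s)) (jacPoly c s m) := jacPoly_ode hc m
  have on : JacobiODE c s (n * (n + s)) (jacPoly c s n) := jacPoly_ode hc n
  have o1 := jacPoly_ode (s := s) hc (l + 1)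
  have o2 := jacPoly_ode (s := s) hc l
  have o3 := jacPoly_ode (s := s) hc (l - 1)
  have z1 := hΛ.mixed om on o1
  have z2 := hΛ.mixed om on o2
  have z3 := hΛ.mixed om on o3
  have hx := jacPoly_X_mul hc hs l
  have hd := jacPoly_eq_derivative hc hs l
  have hl : -recC c s l / (l + s - 1) * ((l - 1 : ℕ) : ℝ) =
      -recC c s l / (l + s - 1) * ((l : ℝ) - 1) := by
    rcases l with _ | l
    · simp [recC]
    · push_cast; simp
  have ha : recA c s l = recA c s l / (l + 1) * (l + 1) := by field_simp
  have hg : recC c s l = - (-recC c s l / (l + s - 1)) * (l + s - 1) := by field_simp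
  have h := hΛ.test_identity om on (C (recA c s l / (l + 1)) * jacPoly c s (l + 1) +
      C (derB c s l) * jacPoly c s l + C (-recC c s l / (l + s - 1)) * jacPoly c s (l - 1))
  have hmid := midCoeff_eq c m n (by rwa [mul_comm]) (by rwa [mul_comm])
    (by rwa [mul_comm] : 2 * (l : ℝ) + s - 1 ≠ 0)
  simp only [] at h
  have hL : X * (1 - X) * derivative (derivative (C (recA c s l / (l + 1)) * jacPoly c s (l + 1) +
      C (derB c s l) * jacPoly c s l + C (-recC c s l / (l + s - 1)) * jacPoly c s (l - 1))) +
      (C c - C (s + 1) * X) * derivative (C (recA c s l / (l + 1)) * jacPoly c s (l + 1) +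
      C (derB c s l) * jacPoly c s l + C (-recC c s l / (l + s - 1)) * jacPoly c s (l - 1)) =
      -(C (recA c s l / (l + 1) * ((l + 1) * (l + 1 + s))) * jacPoly c s (l + 1)) -
      C (derB c s l * (l * (l + s))) * jacPoly c s l -
      C (-recC c s l / (l + s - 1) * ((l - 1) * (l - 1 + s))) * jacPoly c s (l - 1) := by
    have hl' : -recC c s l / (l + s - 1) * ((l - 1) * (l - 1 + s)) =
        -recC c s l / (l + s - 1) * (((l - 1 : ℕ) : ℝ) * (((l - 1 : ℕ) : ℝ) + s)) := by
      rcases l with _ | l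
      · simp [recC]
      · push_cast; simp
    rw [hl']
    rw [Nat.cast_add_one] at o1
    simp only [derivative_mul, derivative_add, derivative_C, derivative_zero]
    generalize (l : ℝ) + 1 = l1 at *
    generalize ((l - 1 : ℕ) : ℝ) = l3 at *
    simp only [C_mul] at o1 o2 o3 ⊢
    linear_combination C (recA c s l / l1) * o1 + C (derB c s l) * o2 +
      C (-recC c s l / (l + s - 1)) * o3
  rw [hL, hd] at h
  set Fm := jacPoly c s m
  set Fn := jacPoly c s n
  set F1 := jacPoly c s (l + 1)
  set F2 := jacPoly c s l
  set F3 := jacPoly c s (l - 1)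
  have hsplit : ∀ a1 a2 a3 A B D q0 q1 e0 e1 : ℝ, X * F2 = C A * F1 + C B * F2 + C D * F3 →
      Λ (-((X * (1 - X) * derivative Fm * derivative Fn) *
        (-(C (a1 * ((l + 1) * (l + 1 + s))) * F1) - C (a2 * (l * (l + s))) * F2 -
          C (a3 * ((l - 1) * (l - 1 + s))) * F3)) +
        (C q0 - C q1 * X) * (X * (1 - X) * derivative Fm * derivative Fn) * F2 -
        C e0 * (Fm * Fn * (-(C (a1 * ((l + 1) * (l + 1 + s))) * F1) - C (a2 * (l * (l + s))) * F2 -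
          C (a3 * ((l - 1) * (l - 1 + s))) * F3)) -
        C e1 * (Fm * Fn * (C a1 * F1 + C a2 * F2 + C a3 * F3))) =
      (a1 * ((l + 1) * (l + 1 + s)) - q1 * A) * Λ (X * (1 - X) * derivative Fm * derivative Fn *
          F1) +
      (a2 * (l * (l + s)) + q0 - q1 * B) * Λ (X * (1 - X) * derivative Fm * derivative Fn * F2) +
      (a3 * ((l - 1) * (l - 1 + s)) - q1 * D) * Λ (X * (1 - X) * derivative Fm * derivative Fn *
          F3) +
      (e0 * (a1 * ((l + 1) * (l + 1 + s))) - e1 * a1) * Λ (Fm * Fn * F1) +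
      (e0 * (a2 * (l * (l + s))) - e1 * a2) * Λ (Fm * Fn * F2) +
      (e0 * (a3 * ((l - 1) * (l - 1 + s))) - e1 * a3) * Λ (Fm * Fn * F3) := by
    intro a1 a2 a3 A B D q0 q1 e0 e1 hX
    simp only [← map_C_mul, ← map_add]
    congr 1
    simp only [C_mul, C_add, C_sub, C_1]
    linear_combination -C q1 * (X * (1 - X) * derivative Fm * derivative Fn) * hX
  rw [hsplit _ _ _ _ _ _ _ _ _ _ hx] at h
  have hl2 : -recC c s l / (l + s - 1) * ((l - 1 : ℕ) * ((l - 1 : ℕ) + s) : ℝ) =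
      -recC c s l / (l + s - 1) * (((l : ℝ) - 1) * ((l : ℝ) - 1 + s)) := by
    linear_combination (((l - 1 : ℕ) : ℝ) + s + l - 1) * hl
  have z3' : -recC c s l / (l + s - 1) *
      (2 * Λ (X * (1 - X) * derivative Fm * derivative Fn * F3)) = -recC c s l / (l + s - 1) *
      ((m * (m + s) + n * (n + s) - ((l : ℝ) - 1) * ((l : ℝ) - 1 + s)) * Λ (Fm * Fn * F3)) := by
    rw [z3]
    linear_combination -Λ (Fm * Fn * F3) * hl2
  rw [← hmid]
  push_cast at z1
  generalize recC c s l = rC at *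
  generalize recA c s l = rA at *
  generalize -rC / (l + s - 1) = a3 at *
  generalize rA / (l + 1) = a1 at *
  subst ha hg
  linear_combination 2 * h - (a1 * ((l + 1) * (l + 1 + s)) - 2 * s * (a1 * (l + 1))) * z1 -
    (derB c s l * (l * (l + s)) + (2 * c - 1) -
      2 * s * (-(a1 * (l + 1)) - -a3 * (l + s - 1))) * z2 -
    ((l - 1) * (l - 1 + s) + 2 * s * (l + s - 1)) * z3'

end LinearizationRecurrence

theorem contiguity_polynomial_identity (X Z g h V P : ℝ) :
    Z * ((2*X-1)*(X+1/2-h)*((X+1-g)^2-V)*((X+g)^2-P) * (((X+h)^2-Z^2)*((X+h-1)^2-Z^2)) +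
      (2*X)*(-(2*h)*((X^2-g^2)*(P+V-4*g^2-(X^2-g^2)) - P*V) +
        ((2*g+2*h)*((2*X+1)*(2*X-1)) - 4*g*(2*(X^2-g^2)+(2*g-1)*(g+h+1/2)))*((P+V)/2-g^2-X^2)) *
        (((X-Z)^2-(1-h)^2)*((X+Z)^2-(1-h)^2)) +
      (2*X+1)*(-(X+h-1/2))*((X-1+g)^2-V)*((X-g)^2-P) * (((X+1-h)^2-Z^2)*((X-h)^2-Z^2))) =
    -4*((2*X-1)*(2*X)*(2*X+1)) *
      (((Z+g-h)^2-V)/4*(((Z+1-g-h)^2-P)/4)*((X^2-(Z+h)^2)*(X^2-(Z+h-1)^2)) -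
        ((Z-g+h)^2-V)/4*(((Z-1+g+h)^2-P)/4)*((X^2-(Z-h)^2)*(X^2-(Z-h+1)^2))) := by
  ring

theorem contiguity_polynomial_identity_zero (X g h v P : ℝ) :
    (2*X-1)*(X+1/2-h)*((X+1-g)^2-v^2)*((X+g)^2-P) *
        (((X+h)^2-(g-h+v)^2)*((X+h-1)^2-(g-h+v)^2)) +
      (2*X)*(-(2*h)*((X^2-g^2)*(P+v^2-4*g^2-(X^2-g^2)) - P*v^2) +
        ((2*g+2*h)*((2*X+1)*(2*X-1)) - 4*g*(2*(X^2-g^2)+(2*g-1)*(g+h+1/2)))*((P+v^2)/2-g^2-X^2)) *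
        (((X-(g-h+v))^2-(1-h)^2)*((X+(g-h+v))^2-(1-h)^2)) +
      (2*X+1)*(-(X+h-1/2))*((X-1+g)^2-v^2)*((X-g)^2-P) *
        (((X+1-h)^2-(g-h+v)^2)*((X-h)^2-(g-h+v)^2)) =
    -4*((2*X-1)*(2*X)*(2*X+1)) *
      ((g-h)*((((g-h+v)+1-g-h)^2-P)/4)*((X^2-((g-h+v)+h)^2)*(X^2-((g-h+v)+h-1)^2))) := by
  ring

/-- Coefficient `U` of the three-term recurrence, cleared of denominators. -/
noncomputable def coefU (β s m v l : ℝ) : ℝ :=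
  (2 * l + s - 1) * ((l + β + 1) * (l + 1 - v) * (l + 1 + v) * (2 * s + l + (m + v) + m) *
    (l - (m + v) - m))

/-- Coefficient `V` of the three-term recurrence, cleared of denominators. -/
noncomputable def coefV (β s m v l : ℝ) : ℝ :=
  (2 * l + s) * midNum (s - β) s m (m + v) l

/-- Coefficient `W` of the three-term recurrence, cleared of denominators. -/
noncomputable def coefW (β s m v l : ℝ) : ℝ :=
  (2 * l + s + 1) * -((l + s - 1 - β) * (s + l + (m + v) + m) * (l - s - (m + v) - m) *
    (l - 1 + v + s) * (l - 1 - v + s))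

/-- Summand combination; here `e = α - β = s - 1 - 2β`, and `l = v + k`. -/
noncomputable def bracket (β s m v k j : ℝ) : ℝ :=
  coefU β s m v (v + k) * ((s - 1 - 2 * β + k - 1 - 2 * j) * (s - 1 - 2 * β + k - 2 * j) *
      (s + 2 * v + k - 1 + 2 * j) * (s + 2 * v + k + 2 * j)) +
    coefV β s m v (v + k) * ((s - 1 - 2 * β + k - 1 - 2 * j) * (k + 1 - 2 * j) *
      (s + 2 * v + k - 1 + 2 * j) * (2 * β + 2 * v + 2 + k + 2 * j)) +
    coefW β s m v (v + k) * ((k + 1 - 2 * j) * (k - 2 * j) *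
      (2 * β + 2 * v + 2 + k + 2 * j) * (2 * β + 2 * v + 2 + k - 1 + 2 * j))

/-- Factor of `bracket` carried by the telescoping term at `j`. -/
noncomputable def bracketY (s v k j : ℝ) : ℝ :=
  (k + 1 - 2 * j) * (k - 2 * j) * (s + 2 * v + k - 1 + 2 * j) * (s + 2 * v + k + 2 * j)

/-- Factor of `bracket` carried by the telescoping term at `j - 1`. -/
noncomputable def bracketR (β s v k j : ℝ) : ℝ :=
  (s - 1 - 2 * β + k - 1 - 2 * j) * (s - 1 - 2 * β + k - 2 * j) *
    (2 * β + 2 * v + 2 + k - 1 + 2 * j) * (2 * β + 2 * v + 2 + k + 2 * j)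

/-- Common factor of the two telescoping terms of `bracket`. -/
noncomputable def bracketD (s v k : ℝ) : ℝ :=
  (2 * (v + k) + s - 1) * (2 * (v + k) + s) * (2 * (v + k) + s + 1)

theorem bracket_identity (β s m v k j : ℝ) :
    (β + v + 1 / 2 + 2 * j) * bracket β s m v k j = -4 * bracketD s v k *
      ((β + v + 1 / 2 + j) * (β + 1 / 2 + j) * ((β + (m + v) + 1 + j) * (j + β + 1 - s - m)) *
          bracketY s v k j -
        j * (v + j) * ((j - 1 / 2 - m) * (j + s + (m + v) - 1 / 2)) * bracketR β s v k j) := by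
  have H := contiguity_polynomial_identity (v+k+s/2) (2*j+β+v+1/2) (s/2) ((s-1-2*β)/2) (v^2)
      ((m+v+m+s)^2)
  have u1 : (2*(v+k+s/2)-1)*((v+k+s/2)+1/2-((s-1-2*β)/2))*(((v+k+s/2)+1-(s/2))^2-(v^2))*
      (((v+k+s/2)+(s/2))^2-((m+v+m+s)^2)) =
      coefU β s m v (v + k) := by unfold coefU; ring
  have u2 : (2*(v+k+s/2))*(-(2*((s-1-2*β)/2))*(((v+k+s/2)^2-(s/2)^2)*
      (((m+v+m+s)^2)+(v^2)-4*(s/2)^2-((v+k+s/2)^2-(s/2)^2)) - ((m+v+m+s)^2)*(v^2)) +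
        ((2*(s/2)+2*((s-1-2*β)/2))*((2*(v+k+s/2)+1)*(2*(v+k+s/2)-1)) -
            4*(s/2)*(2*((v+k+s/2)^2-(s/2)^2)+(2*(s/2)-1)*((s/2)+((s-1-2*β)/2)+1/2)))*
            ((((m+v+m+s)^2)+(v^2))/2-(s/2)^2-(v+k+s/2)^2)) =
      coefV β s m v (v + k) := by unfold coefV midNum; ring
  have u3 : (2*(v+k+s/2)+1)*(-((v+k+s/2)+((s-1-2*β)/2)-1/2))*(((v+k+s/2)-1+(s/2))^2-(v^2))*
      (((v+k+s/2)-(s/2))^2-((m+v+m+s)^2)) =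
      coefW β s m v (v + k) := by unfold coefW; ring
  have q1 : ((((v+k+s/2)+((s-1-2*β)/2))^2-(2*j+β+v+1/2)^2)*
      (((v+k+s/2)+((s-1-2*β)/2)-1)^2-(2*j+β+v+1/2)^2)) =
      ((s - 1 - 2 * β + k - 1 - 2 * j) * (s - 1 - 2 * β + k - 2 * j) *
      (s + 2 * v + k - 1 + 2 * j) * (s + 2 * v + k + 2 * j)) := by ring
  have q2 : ((((v+k+s/2)-(2*j+β+v+1/2))^2-(1-((s-1-2*β)/2))^2)*
      (((v+k+s/2)+(2*j+β+v+1/2))^2-(1-((s-1-2*β)/2))^2)) =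
      ((s - 1 - 2 * β + k - 1 - 2 * j) * (k + 1 - 2 * j) *
      (s + 2 * v + k - 1 + 2 * j) * (2 * β + 2 * v + 2 + k + 2 * j)) := by ring
  have q3 : ((((v+k+s/2)+1-((s-1-2*β)/2))^2-(2*j+β+v+1/2)^2)*
      (((v+k+s/2)-((s-1-2*β)/2))^2-(2*j+β+v+1/2)^2)) =
      ((k + 1 - 2 * j) * (k - 2 * j) *
      (2 * β + 2 * v + 2 + k + 2 * j) * (2 * β + 2 * v + 2 + k - 1 + 2 * j)) := by ring
  have x0 : (((2*j+β+v+1/2)+(s/2)-((s-1-2*β)/2))^2-(v^2))/4 =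
      ((β + v + 1/2 + j) * (β + 1/2 + j)) := by ring
  have x1 : (((2*j+β+v+1/2)+1-(s/2)-((s-1-2*β)/2))^2-((m+v+m+s)^2))/4 =
      ((β + (m + v) + 1 + j) * (j + β + 1 - s - m)) := by ring
  have x2 : (((2*j+β+v+1/2)-(s/2)+((s-1-2*β)/2))^2-(v^2))/4 =
      (j * (v + j)) := by ring
  have x3 : (((2*j+β+v+1/2)-1+(s/2)+((s-1-2*β)/2))^2-((m+v+m+s)^2))/4 =
      ((j - 1/2 - m) * (j + s + (m + v) - 1/2)) := by ring
  have y : (((v+k+s/2)^2-((2*j+β+v+1/2)+((s-1-2*β)/2))^2)*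
      ((v+k+s/2)^2-((2*j+β+v+1/2)+((s-1-2*β)/2)-1)^2)) =
      bracketY s v k j := by unfold bracketY; ring
  have r : (((v+k+s/2)^2-((2*j+β+v+1/2)-((s-1-2*β)/2))^2)*
      ((v+k+s/2)^2-((2*j+β+v+1/2)-((s-1-2*β)/2)+1)^2)) =
      bracketR β s v k j := by unfold bracketR; ring
  have d : ((2*(v+k+s/2)-1)*(2*(v+k+s/2))*(2*(v+k+s/2)+1)) =
      bracketD s v k := by unfold bracketD; ring
  rw [u1, u2, u3, q1, q2, q3, x0, x1, x2, x3, y, r, d] at H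
  unfold bracket
  linear_combination H

theorem bracket_zero (β s m v k : ℝ) :
    bracket β s m v k 0 = -4 * bracketD s v k *
      ((β + 1 / 2) * ((β + (m + v) + 1) * (β + 1 - s - m)) * bracketY s v k 0) := by
  have H := contiguity_polynomial_identity_zero (v+k+s/2) (s/2) ((s-1-2*β)/2) v ((m+v+m+s)^2)
  have u1 : (2*(v+k+s/2)-1)*((v+k+s/2)+1/2-((s-1-2*β)/2))*(((v+k+s/2)+1-(s/2))^2-(v^2))*
      (((v+k+s/2)+(s/2))^2-((m+v+m+s)^2)) =
      coefU β s m v (v + k) := by unfold coefU; ring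
  have u2 : (2*(v+k+s/2))*(-(2*((s-1-2*β)/2))*(((v+k+s/2)^2-(s/2)^2)*
      (((m+v+m+s)^2)+(v^2)-4*(s/2)^2-((v+k+s/2)^2-(s/2)^2)) - ((m+v+m+s)^2)*(v^2)) +
        ((2*(s/2)+2*((s-1-2*β)/2))*((2*(v+k+s/2)+1)*(2*(v+k+s/2)-1)) -
            4*(s/2)*(2*((v+k+s/2)^2-(s/2)^2)+(2*(s/2)-1)*((s/2)+((s-1-2*β)/2)+1/2)))*
            ((((m+v+m+s)^2)+(v^2))/2-(s/2)^2-(v+k+s/2)^2)) =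
      coefV β s m v (v + k) := by unfold coefV midNum; ring
  have u3 : (2*(v+k+s/2)+1)*(-((v+k+s/2)+((s-1-2*β)/2)-1/2))*(((v+k+s/2)-1+(s/2))^2-(v^2))*
      (((v+k+s/2)-(s/2))^2-((m+v+m+s)^2)) =
      coefW β s m v (v + k) := by unfold coefW; ring
  have q1 : ((((v+k+s/2)+((s-1-2*β)/2))^2-(s/2-(s-1-2*β)/2+v)^2)*
      (((v+k+s/2)+((s-1-2*β)/2)-1)^2-(s/2-(s-1-2*β)/2+v)^2)) =
      ((s - 1 - 2 * β + k - 1 - 2 * 0) * (s - 1 - 2 * β + k - 2 * 0) *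
      (s + 2 * v + k - 1 + 2 * 0) * (s + 2 * v + k + 2 * 0)) := by ring
  have q2 : ((((v+k+s/2)-(s/2-(s-1-2*β)/2+v))^2-(1-((s-1-2*β)/2))^2)*
      (((v+k+s/2)+(s/2-(s-1-2*β)/2+v))^2-(1-((s-1-2*β)/2))^2)) =
      ((s - 1 - 2 * β + k - 1 - 2 * 0) * (k + 1 - 2 * 0) *
      (s + 2 * v + k - 1 + 2 * 0) * (2 * β + 2 * v + 2 + k + 2 * 0)) := by ring
  have q3 : ((((v+k+s/2)+1-((s-1-2*β)/2))^2-(s/2-(s-1-2*β)/2+v)^2)*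
      (((v+k+s/2)-((s-1-2*β)/2))^2-(s/2-(s-1-2*β)/2+v)^2)) =
      ((k + 1 - 2 * 0) * (k - 2 * 0) *
      (2 * β + 2 * v + 2 + k + 2 * 0) * (2 * β + 2 * v + 2 + k - 1 + 2 * 0)) := by ring
  have x0 : ((s/2)-((s-1-2*β)/2)) =
      (β + 1/2) := by ring
  have x1 : (((s/2-(s-1-2*β)/2+v)+1-(s/2)-((s-1-2*β)/2))^2-((m+v+m+s)^2))/4 =
      ((β + (m + v) + 1) * (β + 1 - s - m)) := by ring
  have y : (((v+k+s/2)^2-((s/2-(s-1-2*β)/2+v)+((s-1-2*β)/2))^2)*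
      ((v+k+s/2)^2-((s/2-(s-1-2*β)/2+v)+((s-1-2*β)/2)-1)^2)) =
      bracketY s v k 0 := by unfold bracketY; ring
  have d : ((2*(v+k+s/2)-1)*(2*(v+k+s/2))*(2*(v+k+s/2)+1)) =
      bracketD s v k := by unfold bracketD; ring
  rw [u1, u2, u3, q1, q2, q3, x1, y, d, x0] at H
  unfold bracket
  linear_combination H

section Contiguity

/-- The factor `(a)_j (a/2 + 1)_j / (a/2)_j`, in a form that also makes sense for `a = 0`. -/
noncomputable def wellPoised (a : ℝ) : ℕ → ℝ
  | 0 => 1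
  | j + 1 => poch (a + 1) j * (a + 2 * (j + 1))

/-- The part of the summand of the `₉F₈` series that does not depend on `k`. -/
noncomputable def summandD (β s m v : ℝ) (j : ℕ) : ℝ :=
  wellPoised (β + v + 1 / 2) j * poch (β + 1 / 2) j * poch (β + (m + v) + 1) j *
    poch (β + 1 - s - m) j /
    (poch (v + 1) j * poch (1 / 2 - m) j * poch (s + (m + v) + 1 / 2) j * j.factorial)

/-- The part of the summand of the `₉F₈` series that depends on `k`. -/
noncomputable def summandT (β s v k : ℝ) (j : ℕ) : ℝ :=
  poch (-k) (2 * j) * poch (s + 2 * v + k) (2 * j) /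
    (poch (2 * β + 2 - s - k) (2 * j) * poch (2 * β + 2 * v + 2 + k) (2 * j))

/-- Factor common to the `k`-dependent parts of three neighbouring summands. -/
noncomputable def summandP (β s v k : ℝ) (j : ℕ) : ℝ :=
  poch (-k - 1) (2 * j) * poch (s + 2 * v + k - 1) (2 * j) /
    (poch (2 * β + 3 - s - k) (2 * j) * poch (2 * β + 2 * v + 3 + k) (2 * j))

/-- The `k`-independent part of the telescoping antidifference. -/
noncomputable def summandE (β s m v : ℝ) (j : ℕ) : ℝ :=
  poch (β + v + 1 / 2 + 1) j * poch (β + 1 / 2) (j + 1) * poch (β + (m + v) + 1) (j + 1) *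
    poch (β + 1 - s - m) (j + 1) /
    (poch (v + 1) j * poch (1 / 2 - m) j * poch (s + (m + v) + 1 / 2) j * j.factorial)

theorem poch_mul_shift_two (a : ℝ) (j : ℕ) :
    poch a j * ((a + j) * (a + 1 + j)) = a * (a + 1) * poch (a + 2) j := by
  have h1 := poch_mul_shift a j
  have h2 := poch_mul_shift (a + 1) j
  rw [show a + 1 + 1 = a + 2 by ring] at h2
  linear_combination (a + 1 + j) * h1 + a * h2

variable {β s m v k : ℝ}

theorem summandT_add_one (j : ℕ)
    (h1 : ∀ i : ℕ, 2 * β + 1 - s - k + i ≠ 0) (h2 : ∀ i : ℕ, 2 * β + 2 * v + 3 + k + i ≠ 0) :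
    summandT β s v (k + 1) j * ((s - 1 - 2 * β + k) * (s - 1 - 2 * β + k - 1) *
        ((s + 2 * v + k) * (s + 2 * v + k - 1))) =
      summandP β s v k j * ((s - 1 - 2 * β + k - 1 - 2 * j) * (s - 1 - 2 * β + k - 2 * j) *
        (s + 2 * v + k - 1 + 2 * j) * (s + 2 * v + k + 2 * j)) := by
  have e1 := poch_mul_shift_two (s + 2 * v + k - 1) (2 * j)
  have e2 := poch_mul_shift_two (2 * β + 1 - s - k) (2 * j)
  have n1 := poch_ne_zero h1 (2 * j)
  have n2 := poch_ne_zero h2 (2 * j)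
  have n3 : poch (2 * β + 3 - s - k) (2 * j) ≠ 0 := poch_ne_zero (fun i => by
    have := h1 (i + 2); push_cast at this; intro h; apply this; linarith) _
  unfold summandT summandP
  rw [show -(k + 1) = -k - 1 by ring, show s + 2 * v + (k + 1) = s + 2 * v + k - 1 + 2 by ring,
    show 2 * β + 2 - s - (k + 1) = 2 * β + 1 - s - k by ring,
    show 2 * β + 2 * v + 2 + (k + 1) = 2 * β + 2 * v + 3 + k by ring]
  rw [show 2 * β + 1 - s - k + 2 = 2 * β + 3 - s - k by ring] at e2
  push_cast at e1 e2
  rw [div_mul_eq_mul_div, div_mul_eq_mul_div, div_eq_div_iff (mul_ne_zero n1 n2)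
    (mul_ne_zero n3 n2)]
  generalize poch (s + 2 * v + k - 1 + 2) (2 * j) = A2 at *
  generalize poch (s + 2 * v + k - 1) (2 * j) = A0 at *
  generalize poch (2 * β + 3 - s - k) (2 * j) = C2 at *
  generalize poch (2 * β + 1 - s - k) (2 * j) = C0 at *
  linear_combination -poch (-k - 1) (2 * j) * poch (2 * β + 2 * v + 3 + k) (2 * j) *
    (C2 * (s - 1 - 2 * β + k) * (s - 1 - 2 * β + k - 1) * e1 +
      A0 * (s + 2 * v + k - 1 + 2 * j) * (s + 2 * v + k + 2 * j) * e2)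

theorem summandT_self (j : ℕ)
    (h1 : ∀ i : ℕ, 2 * β + 1 - s - k + i ≠ 0) (h2 : ∀ i : ℕ, 2 * β + 2 * v + 2 + k + i ≠ 0) :
    summandT β s v k j * ((s + 2 * v + k - 1) * (s - 1 - 2 * β + k - 1) *
        ((k + 1) * (2 * β + 2 * v + 2 + k))) =
      summandP β s v k j * ((s - 1 - 2 * β + k - 1 - 2 * j) * (k + 1 - 2 * j) *
        (s + 2 * v + k - 1 + 2 * j) * (2 * β + 2 * v + 2 + k + 2 * j)) := by
  have e1 := poch_mul_shift (s + 2 * v + k - 1) (2 * j)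
  have e2 := poch_mul_shift (2 * β + 2 - s - k) (2 * j)
  have e3 := poch_mul_shift (-k - 1) (2 * j)
  have e4 := poch_mul_shift (2 * β + 2 * v + 2 + k) (2 * j)
  have n1 : poch (2 * β + 2 - s - k) (2 * j) ≠ 0 := poch_ne_zero (fun i => by
    have := h1 (i + 1); push_cast at this; intro h; apply this; linarith) _
  have n2 := poch_ne_zero h2 (2 * j)
  have n3 : poch (2 * β + 3 - s - k) (2 * j) ≠ 0 := poch_ne_zero (fun i => by
    have := h1 (i + 2); push_cast at this; intro h; apply this; linarith) _
  have n4 : poch (2 * β + 2 * v + 3 + k) (2 * j) ≠ 0 := poch_ne_zero (fun i => by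
    have := h2 (i + 1); push_cast at this; intro h; apply this; linarith) _
  unfold summandT summandP
  rw [show 2 * β + 2 - s - k + 1 = 2 * β + 3 - s - k by ring] at e2
  rw [show s + 2 * v + k - 1 + 1 = s + 2 * v + k by ring] at e1
  rw [show -k - 1 + 1 = -k by ring] at e3
  rw [show 2 * β + 2 * v + 2 + k + 1 = 2 * β + 2 * v + 3 + k by ring] at e4
  push_cast at e1 e2 e3 e4
  rw [div_mul_eq_mul_div, div_mul_eq_mul_div, div_eq_div_iff (mul_ne_zero n1 n2)
    (mul_ne_zero n3 n4)]
  generalize poch (s + 2 * v + k) (2 * j) = A1 at *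
  generalize poch (s + 2 * v + k - 1) (2 * j) = A0 at *
  generalize poch (2 * β + 3 - s - k) (2 * j) = C1 at *
  generalize poch (2 * β + 2 - s - k) (2 * j) = C0 at *
  generalize poch (-k) (2 * j) = K1 at *
  generalize poch (-k - 1) (2 * j) = K0 at *
  generalize poch (2 * β + 2 * v + 3 + k) (2 * j) = B1 at *
  generalize poch (2 * β + 2 * v + 2 + k) (2 * j) = B0 at *
  generalize 2 * β + 2 * v + 2 + k = b at *
  generalize s + 2 * v + k - 1 = a at *
  obtain ⟨x, rfl⟩ : ∃ x, s = 2 * β + 2 - k - x := ⟨2 * β + 2 - k - s, by ring⟩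
  rw [show 2 * β + 2 - (2 * β + 2 - k - x) - k = x by ring] at e2
  rw [show 2 * β + 2 - k - x - 1 - 2 * β + k - 1 = -x by ring]
  have E : K1 * A1 * C1 * B1 * ((k + 1) * a * x * b) = K0 * A0 * C0 * B0 *
      ((k + 1 - 2 * j) * (a + 2 * j) * (x + 2 * j) * (b + 2 * j)) := by
    calc _ = -((-k - 1) * K1) * (a * A1) * (x * C1) * (b * B1) := by ring
      _ = _ := by rw [← e1, ← e2, ← e3, ← e4]; ring
  linear_combination -E

theorem summandT_sub_one (j : ℕ)
    (h1 : ∀ i : ℕ, 2 * β + 1 - s - k + i ≠ 0) (h2 : ∀ i : ℕ, 2 * β + 2 * v + 1 + k + i ≠ 0) :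
    summandT β s v (k - 1) j * (k * (k + 1) *
        ((2 * β + 2 * v + 2 + k) * (2 * β + 2 * v + 2 + k - 1))) =
      summandP β s v k j * ((k + 1 - 2 * j) * (k - 2 * j) *
        (2 * β + 2 * v + 2 + k + 2 * j) * (2 * β + 2 * v + 2 + k - 1 + 2 * j)) := by
  have e1 := poch_mul_shift_two (-k - 1) (2 * j)
  have e2 := poch_mul_shift_two (2 * β + 2 * v + 1 + k) (2 * j)
  have n2 := poch_ne_zero h2 (2 * j)
  have n3 : poch (2 * β + 3 - s - k) (2 * j) ≠ 0 := poch_ne_zero (fun i => by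
    have := h1 (i + 2); push_cast at this; intro h; apply this; linarith) _
  have n4 : poch (2 * β + 2 * v + 3 + k) (2 * j) ≠ 0 := poch_ne_zero (fun i => by
    have := h2 (i + 2); push_cast at this; intro h; apply this; linarith) _
  unfold summandT summandP
  rw [show 2 * β + 2 - s - (k - 1) = 2 * β + 3 - s - k by ring,
    show -(k - 1) = -k - 1 + 2 by ring, show s + 2 * v + (k - 1) = s + 2 * v + k - 1 by ring,
    show 2 * β + 2 * v + 2 + (k - 1) = 2 * β + 2 * v + 1 + k by ring]
  rw [show 2 * β + 2 * v + 1 + k + 2 = 2 * β + 2 * v + 3 + k by ring] at e2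
  push_cast at e1 e2
  rw [div_mul_eq_mul_div, div_mul_eq_mul_div, div_eq_div_iff (mul_ne_zero n3 n2)
    (mul_ne_zero n3 n4)]
  generalize poch (2 * β + 3 - s - k) (2 * j) = C1 at *
  generalize poch (-k - 1 + 2) (2 * j) = K1 at *
  generalize poch (-k - 1) (2 * j) = K0 at *
  generalize poch (2 * β + 2 * v + 3 + k) (2 * j) = B1 at *
  generalize poch (2 * β + 2 * v + 1 + k) (2 * j) = B0 at *
  generalize poch (s + 2 * v + k - 1) (2 * j) = A0 at *
  linear_combination -C1 * A0 * (B1 * (2 * β + 2 * v + 2 + k) * (2 * β + 2 * v + 2 + k - 1) * e1 +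
    K0 * (k + 1 - 2 * j) * (k - 2 * j) * e2)

theorem summandP_succ (j : ℕ)
    (h1 : ∀ i : ℕ, 2 * β + 1 - s - k + i ≠ 0) (h2 : ∀ i : ℕ, 2 * β + 2 * v + 3 + k + i ≠ 0) :
    summandP β s v k (j + 1) * bracketR β s v k (j + 1) =
      summandP β s v k j * bracketY s v k j := by
  have n3 : ∀ i : ℕ, 2 * β + 3 - s - k + i ≠ 0 := (fun i => by
    have := h1 (i + 2); push_cast at this; intro h; apply this; linarith)
  have m1 := poch_ne_zero n3 (2 * j)
  have m2 := poch_ne_zero h2 (2 * j)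
  have p1 := n3 (2 * j)
  have p2 := n3 (2 * j + 1)
  have p3 := h2 (2 * j)
  have p4 := h2 (2 * j + 1)
  push_cast at p1 p2 p3 p4
  unfold summandP bracketY bracketR
  rw [show 2 * (j + 1) = 2 * j + 1 + 1 by ring]
  simp only [poch_succ]
  push_cast
  rw [div_mul_eq_mul_div, div_mul_eq_mul_div, div_eq_div_iff (by positivity) (by positivity)]
  ring

theorem summandD_succ_eq (j : ℕ) (h1 : ∀ i : ℕ, v + 1 + i ≠ 0) (h2 : ∀ i : ℕ, 1 / 2 - m + i ≠ 0)
    (h3 : ∀ i : ℕ, s + (m + v) + 1 / 2 + i ≠ 0) : ∃ q : ℝ,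
    summandD β s m v (j + 1) = q * (β + v + 1 / 2 + 2 * (j + 1)) ∧
    summandE β s m v (j + 1) = q * ((β + v + 1 / 2 + (j + 1)) * (β + 1 / 2 + (j + 1)) *
      ((β + (m + v) + 1 + (j + 1)) * ((j + 1) + β + 1 - s - m))) ∧
    summandE β s m v j = q * ((j + 1) * (v + (j + 1)) *
      (((j + 1) - 1 / 2 - m) * ((j + 1) + s + (m + v) - 1 / 2))) := by
  have n1 := poch_ne_zero h1 j
  have n2 := poch_ne_zero h2 j
  have n3 := poch_ne_zero h3 j
  have n4 : (j.factorial : ℝ) ≠ 0 := by positivity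
  have n5 : (j : ℝ) + 1 ≠ 0 := by positivity
  have p1 := h1 j
  have p2 := h2 j
  have p3 := h3 j
  refine ⟨poch (β + v + 1 / 2 + 1) j * poch (β + 1 / 2) (j + 1) * poch (β + (m + v) + 1) (j + 1) *
    poch (β + 1 - s - m) (j + 1) / (poch (v + 1) (j + 1) * poch (1 / 2 - m) (j + 1) *
      poch (s + (m + v) + 1 / 2) (j + 1) * (j + 1).factorial), ?_, ?_, ?_⟩
  · simp only [summandD, wellPoised]
    ring
  · simp only [summandE]
    rw [poch_succ _ (j + 1), poch_succ _ (j + 1), poch_succ _ (j + 1), poch_succ _ j]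
    push_cast
    ring
  · simp only [summandE]
    rw [poch_succ (v + 1), poch_succ (1 / 2 - m), poch_succ (s + (m + v) + 1 / 2),
      Nat.factorial_succ]
    push_cast
    rw [show v + ((j : ℝ) + 1) = v + 1 + j by ring,
      show (j : ℝ) + 1 - 1 / 2 - m = 1 / 2 - m + j by ring,
      show (j : ℝ) + 1 + s + (m + v) - 1 / 2 = s + (m + v) + 1 / 2 + j by ring]
    generalize v + 1 + (j : ℝ) = x1 at *
    generalize 1 / 2 - m + (j : ℝ) = x2 at *
    generalize s + (m + v) + 1 / 2 + (j : ℝ) = x3 at *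
    generalize poch (v + 1) j = y1 at *
    generalize poch (1 / 2 - m) j = y2 at *
    generalize poch (s + (m + v) + 1 / 2) j = y3 at *
    field_simp

theorem sum_bracket (N : ℕ) (h1 : ∀ i : ℕ, v + 1 + i ≠ 0) (h2 : ∀ i : ℕ, 1 / 2 - m + i ≠ 0)
    (h3 : ∀ i : ℕ, s + (m + v) + 1 / 2 + i ≠ 0)
    (h4 : ∀ i : ℕ, 2 * β + 1 - s - k + i ≠ 0) (h5 : ∀ i : ℕ, 2 * β + 2 * v + 3 + k + i ≠ 0) :
    ∑ j ∈ Finset.range (N + 1), summandD β s m v j * summandP β s v k j * bracket β s m v k j =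
      -4 * bracketD s v k * (summandE β s m v N * bracketY s v k N * summandP β s v k N) := by
  induction N with
  | zero =>
    simp only [zero_add, Finset.sum_range_one, Nat.cast_zero, bracket_zero, summandD, summandP,
      wellPoised, summandE, poch_zero, mul_zero, poch_succ, Nat.factorial_zero, Nat.cast_one]
    ring
  | succ N ih =>
    obtain ⟨q, q1, q2, q3⟩ := summandD_succ_eq (β := β) N h1 h2 h3
    have hb := bracket_identity β s m v k (N + 1)
    have hP := summandP_succ (v := v) N h4 h5
    rw [Finset.sum_range_succ, ih, q1, q2, q3]
    push_cast
    linear_combination q * summandP β s v k (N + 1) * hb + 4 * bracketD s v k * q *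
      ((N + 1) * (v + (N + 1)) *
        (((N + 1) - 1 / 2 - m) * ((N + 1) + s + (m + v) - 1 / 2))) * hP

/-- The terminating series attached to the linearization coefficient. -/
noncomputable def contigSum (β s m v : ℝ) (k : ℕ) : ℝ :=
  ∑ j ∈ Finset.range (k + 1), summandD β s m v j * summandT β s v k j

theorem sum_eq_contigSum (β s m v : ℝ) {k M : ℕ} (h : k + 1 ≤ M) :
    ∑ j ∈ Finset.range M, summandD β s m v j * summandT β s v k j = contigSum β s m v k := by
  refine (Finset.sum_subset (Finset.range_subset_range.2 h) fun j _ hj => ?_).symm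
  rw [Finset.mem_range, not_lt] at hj
  rw [summandT, poch_neg_nat_eq_zero (by omega)]
  simp

theorem contigSum_recurrence {k : ℕ} (h1 : ∀ i : ℕ, v + 1 + i ≠ 0)
    (h2 : ∀ i : ℕ, 1 / 2 - m + i ≠ 0) (h3 : ∀ i : ℕ, s + (m + v) + 1 / 2 + i ≠ 0)
    (h4 : ∀ i : ℕ, 2 * β + 1 - s - k + i ≠ 0) (h5 : ∀ i : ℕ, 2 * β + 2 * v + 2 + i ≠ 0) :
    coefU β s m v (v + k) * ((s - 1 - 2 * β + k) * (s - 1 - 2 * β + k - 1) *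
        ((s + 2 * v + k) * (s + 2 * v + k - 1))) * contigSum β s m v (k + 1) +
      coefV β s m v (v + k) * ((s + 2 * v + k - 1) * (s - 1 - 2 * β + k - 1) *
        ((k + 1) * (2 * β + 2 * v + 2 + k))) * contigSum β s m v k +
      coefW β s m v (v + k) * (k * (k + 1) *
        ((2 * β + 2 * v + 2 + k) * (2 * β + 2 * v + 2 + k - 1))) * contigSum β s m v (k - 1) =
      0 := by
  have h6 : ∀ i : ℕ, 2 * β + 2 * v + 2 + k + i ≠ 0 := fun i => by
    have := h5 (k + i); push_cast at this; intro h; apply this; linarith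
  have h7 : ∀ i : ℕ, 2 * β + 2 * v + 3 + k + i ≠ 0 := fun i => by
    have := h5 (k + i + 1); push_cast at this; intro h; apply this; linarith
  have h := sum_bracket (k + 1) h1 h2 h3 h4 h7
  have hP : summandP β s v k (k + 1) = 0 := by
    rw [summandP, show -(k : ℝ) - 1 = -((k + 1 : ℕ) : ℝ) by push_cast; ring,
      poch_neg_nat_eq_zero (by omega)]
    simp
  have hk : k * contigSum β s m v (k - 1) = ∑ j ∈ Finset.range (k + 1 + 1),
      k * (summandD β s m v j * summandT β s v ((k : ℝ) - 1) j) := by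
    rcases k with _ | k
    · simp
    · rw [← Finset.mul_sum, Nat.cast_add_one, add_sub_cancel_right, sum_eq_contigSum _ _ _ _
        (by omega), Nat.add_sub_cancel]
  rw [hP, mul_zero, mul_zero] at h
  rw [← h]
  have e1 := sum_eq_contigSum β s m v (le_refl (k + 1 + 1))
  have e2 := sum_eq_contigSum β s m v (Nat.le_succ (k + 1))
  push_cast at e1
  calc _ = coefU β s m v (v + k) * ((s - 1 - 2 * β + k) * (s - 1 - 2 * β + k - 1) *
        ((s + 2 * v + k) * (s + 2 * v + k - 1))) * contigSum β s m v (k + 1) +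
      coefV β s m v (v + k) * ((s + 2 * v + k - 1) * (s - 1 - 2 * β + k - 1) *
        ((k + 1) * (2 * β + 2 * v + 2 + k))) * contigSum β s m v k +
      coefW β s m v (v + k) * ((k + 1) *
        ((2 * β + 2 * v + 2 + k) * (2 * β + 2 * v + 2 + k - 1))) *
          (k * contigSum β s m v (k - 1)) := by ring
    _ = _ := by
      rw [← e1, ← e2, hk, Finset.mul_sum, Finset.mul_sum, Finset.mul_sum,
        ← Finset.sum_add_distrib, ← Finset.sum_add_distrib]
      refine Finset.sum_congr rfl fun j _ => ?_
      have t1 := summandT_add_one (v := v) j h4 h7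
      have t2 := summandT_self (v := v) j h4 h6
      have t3 : summandT β s v ((k : ℝ) - 1) j * (k * (k + 1) *
            ((2 * β + 2 * v + 2 + k) * (2 * β + 2 * v + 2 + k - 1))) =
          summandP β s v k j * ((k + 1 - 2 * j) * (k - 2 * j) *
            (2 * β + 2 * v + 2 + k + 2 * j) * (2 * β + 2 * v + 2 + k - 1 + 2 * j)) := by
        rcases k with _ | k
        · rcases j with _ | j
          · simp
          · rw [summandP, show -((0 : ℕ) : ℝ) - 1 = -((1 : ℕ) : ℝ) by simp,
              poch_neg_nat_eq_zero (by omega)]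
            simp
        · refine summandT_sub_one (v := v) j h4 fun i => ?_
          have := h5 (k + i); push_cast at this ⊢; intro h; apply this; linarith
      unfold bracket
      linear_combination summandD β s m v j * (coefU β s m v (v + k) * t1 +
        coefV β s m v (v + k) * t2 + coefW β s m v (v + k) * t3)

end Contiguity

section TripleProduct

open Polynomial

theorem wellPoised_eq {a : ℝ} (h : ∀ i : ℕ, a / 2 + i ≠ 0) (j : ℕ) :
    wellPoised a j = poch a j * poch (a / 2 + 1) j / poch (a / 2) j := by
  have h0 : a / 2 ≠ 0 := by simpa using h 0
  have ha : a ≠ 0 := fun e => h0 (by rw [e, zero_div])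
  rcases j with _ | j
  · simp [wellPoised, poch_zero]
  have h1 := poch_mul_shift (a / 2) (j + 1)
  have h2 := poch_ne_zero h (j + 1)
  rw [wellPoised, eq_div_iff h2, poch_succ_left a]
  push_cast at h1 ⊢
  linear_combination 2 * poch (a + 1) j * h1

theorem hypSum_eq_contigSum {α β : ℝ} {m v k : ℕ} (hβ : -1 < β) :
    hypSum
      [β + ((m + v : ℕ) : ℝ) - m + 1 / 2, (β + ((m + v : ℕ) : ℝ) - m + 5 / 2) / 2, β + 1 / 2,
        β + ((m + v : ℕ) : ℝ) + 1, -α - (m : ℝ),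
        (α + β + (k : ℝ) + 1) / 2 + ((m + v : ℕ) : ℝ) - m,
        (α + β + (k : ℝ) + 2) / 2 + ((m + v : ℕ) : ℝ) - m, -(k : ℝ) / 2, (1 - (k : ℝ)) / 2]
      [(β + ((m + v : ℕ) : ℝ) - m + 1 / 2) / 2, ((m + v : ℕ) : ℝ) - m + 1, 1 / 2 - (m : ℝ),
        α + β + ((m + v : ℕ) : ℝ) + 3 / 2, (β - α - (k : ℝ) + 1) / 2,
        (β - α - (k : ℝ) + 2) / 2, ((k : ℝ) + 2) / 2 + β + ((m + v : ℕ) : ℝ) - m,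
        ((k : ℝ) + 3) / 2 + β + ((m + v : ℕ) : ℝ) - m] 1 =
      contigSum β (α + β + 1) m v k := by
  have q1 (j : ℕ) := poch_two_mul (-(k : ℝ)) j
  have q2 (j : ℕ) := poch_two_mul (α + β + 1 + 2 * v + k) j
  have q3 (j : ℕ) := poch_two_mul (2 * β + 2 - (α + β + 1) - k) j
  have q4 (j : ℕ) := poch_two_mul (2 * β + 2 * v + 2 + k) j
  unfold hypSum contigSum
  push_cast
  rw [show β + ((m : ℝ) + v) - m + 1 / 2 = β + v + 1 / 2 by ring,
    show (β + ((m : ℝ) + v) - m + 5 / 2) / 2 = (β + v + 1 / 2) / 2 + 1 by ring,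
    show -α - (m : ℝ) = β + 1 - (α + β + 1) - m by ring,
    show (α + β + (k : ℝ) + 1) / 2 + ((m : ℝ) + v) - m = (α + β + 1 + 2 * v + k) / 2 by ring,
    show (α + β + (k : ℝ) + 2) / 2 + ((m : ℝ) + v) - m = (α + β + 1 + 2 * v + k + 1) / 2 by ring,
    show (m : ℝ) + v - m + 1 = v + 1 by ring,
    show α + β + ((m : ℝ) + v) + 3 / 2 = α + β + 1 + (m + v) + 1 / 2 by ring,
    show (β - α - (k : ℝ) + 1) / 2 = (2 * β + 2 - (α + β + 1) - k) / 2 by ring,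
    show (β - α - (k : ℝ) + 2) / 2 = (2 * β + 2 - (α + β + 1) - k + 1) / 2 by ring,
    show ((k : ℝ) + 2) / 2 + β + ((m : ℝ) + v) - m = (2 * β + 2 * v + 2 + k) / 2 by ring,
    show ((k : ℝ) + 3) / 2 + β + ((m : ℝ) + v) - m = (2 * β + 2 * v + 2 + k + 1) / 2 by ring,
    show (1 - (k : ℝ)) / 2 = (-k + 1) / 2 by ring]
  simp only [List.map_cons, List.map_nil, List.prod_cons, List.prod_nil, one_pow, mul_one]
  rw [tsum_eq_sum (s := Finset.range (k + 1))]
  · refine Finset.sum_congr rfl fun j _ => ?_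
    rw [summandT, q1, q2, q3, q4, summandD]
    have h4 : (4 : ℝ) ^ j ≠ 0 := by positivity
    by_cases h : ∀ i : ℕ, (β + v + 1 / 2) / 2 + i ≠ 0
    · rw [wellPoised_eq h]
      generalize poch ((β + v + 1 / 2) / 2) j = y0
      generalize poch (v + 1 : ℝ) j = y1
      generalize poch (1 / 2 - m : ℝ) j = y2
      generalize poch (α + β + 1 + (m + v) + 1 / 2) j = y3
      rw [mul_mul_mul_comm ((4 : ℝ) ^ j) _ ((4 : ℝ) ^ j), mul_mul_mul_comm ((4 : ℝ) ^ j) _ ((4 : ℝ)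
          ^ j),
        mul_div_mul_left _ _ (mul_ne_zero h4 h4)]
      simp only [div_eq_mul_inv, mul_inv]
      ring
    · push Not at h
      obtain ⟨i, hi⟩ := h
      have hv : (v : ℝ) + 2 * i < 1 / 2 := by linarith
      have hv0 : v = 0 := by
        have : v < 1 := by
          have : (v : ℝ) < 1 := by have : (0 : ℝ) ≤ i := by positivity
                                   linarith
          exact_mod_cast this
        omega
      have hi0 : i = 0 := by
        have : i < 1 := by
          have : (i : ℝ) < 1 := by have : (0 : ℝ) ≤ v := by positivity
                                   linarith
          exact_mod_cast this
        omega
      subst hv0 hi0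
      have hb : β + 1 / 2 = 0 := by simp at hi; linarith
      rcases j with _ | j
      · simp [wellPoised, poch_zero]
      · rw [hb, poch_succ_left 0]; simp
  · intro j hj
    rw [Finset.mem_range, not_lt] at hj
    have := q1 j
    rw [poch_neg_nat_eq_zero (by omega), eq_comm, mul_eq_zero, mul_eq_zero] at this
    rcases this with h | h | h
    · exact absurd h (by positivity)
    · rw [h]; simp
    · rw [h]; simp

variable {β s : ℝ} {Λ : ℝ[X] →ₗ[ℝ] ℝ}

theorem jacCoeff_self (c s : ℝ) (n : ℕ) :
    jacCoeff c s n n = (-1) ^ n * (poch (n + s) n / poch c n) := by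
  have h : (n.factorial : ℝ) ≠ 0 := by positivity
  rw [jacCoeff, poch_neg_self, mul_assoc, mul_comm (n.factorial : ℝ), mul_div_assoc,
    mul_div_mul_right _ _ h]

/-- The value of `Λ (F_m F_{m+v} F_{v+k})` up to a terminating series. -/
noncomputable def triplePrefactor (β s : ℝ) (m v k : ℕ) : ℝ :=
  poch (v + 1) k * poch (β + 1 + v) k * poch (2 * s + 2 * (m + v)) k * poch (-2 * m) k *
    poch (s - 1 - 2 * β) k * poch (s + 2 * v) k /
    (poch (s - β + v) k * poch (s + v) k * poch (s + 2 * (m + v) + 1) k *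
      poch (1 - s - 2 * m) k * k.factorial * poch (2 * β + 2 * v + 2) k)

theorem triplePrefactor_succ (hβ : -1 < β) (hc : ∀ j : ℕ, s - β + j ≠ 0)
    (hs : ∀ z : ℤ, s ≠ z) (m v k : ℕ) :
    triplePrefactor β s m v (k + 1) *
        ((s - β + v + k) * (s + v + k) * (s + 2 * (m + v) + 1 + k) * (1 - s - 2 * m + k) *
          (k + 1) * (2 * β + 2 * v + 2 + k)) =
      triplePrefactor β s m v k *
        ((v + 1 + k) * (β + 1 + v + k) * (2 * s + 2 * (m + v) + k) * (-2 * m + k) *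
          (s - 1 - 2 * β + k) * (s + 2 * v + k)) := by
  have h1 : s - β + v + k ≠ 0 := by
    have := hc (v + k); push_cast at this; rwa [← add_assoc] at this
  have h2 : s + v + k ≠ 0 := by
    have := add_intCast_ne_zero hs (v + k); push_cast at this; rwa [← add_assoc] at this
  have h3 : s + 2 * (m + v) + 1 + k ≠ 0 := by
    have := add_intCast_ne_zero hs (2 * (m + v) + 1 + k); push_cast at this
    intro h; apply this; linarith
  have h4 : 1 - s - 2 * m + k ≠ 0 := by
    have := add_intCast_ne_zero hs (2 * m - 1 - k); push_cast at this
    intro h; apply this; linarith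
  have h5 : (k : ℝ) + 1 ≠ 0 := by positivity
  have h6 : 2 * β + 2 * v + 2 + k ≠ 0 := by
    have : (0 : ℝ) ≤ v := by positivity
    have : (0 : ℝ) ≤ k := by positivity
    intro h; linarith
  simp only [triplePrefactor, poch_succ, Nat.factorial_succ]
  push_cast
  generalize s - β + v + (k : ℝ) = x1 at *
  generalize s + v + (k : ℝ) = x2 at *
  generalize s + 2 * (m + v) + 1 + (k : ℝ) = x3 at *
  generalize 1 - s - 2 * m + (k : ℝ) = x4 at *
  generalize (k : ℝ) + 1 = x5 at *
  generalize 2 * β + 2 * v + 2 + (k : ℝ) = x6 at *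
  rw [div_mul_eq_mul_div, div_mul_eq_mul_div,
    show poch (s - β + v) k * x1 * (poch (s + v) k * x2) * (poch (s + 2 * (m + v) + 1) k * x3) *
      (poch (1 - s - 2 * m) k * x4) * (x5 * k.factorial) * (poch (2 * β + 2 * v + 2) k * x6) =
      (poch (s - β + v) k * poch (s + v) k * poch (s + 2 * (m + v) + 1) k *
      poch (1 - s - 2 * m) k * k.factorial * poch (2 * β + 2 * v + 2) k) *
      (x1 * x2 * x3 * x4 * x5 * x6) by ring, mul_div_mul_right _ _ (by positivity)]
  ring

theorem IsJacobiFunctional.triple_zero (hΛ : IsJacobiFunctional (s - β) s Λ)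
    (hc : ∀ j : ℕ, s - β + j ≠ 0) (hs : ∀ z : ℤ, s ≠ z) (m v : ℕ) :
    Λ (jacPoly (s - β) s m * jacPoly (s - β) s (m + v) * jacPoly (s - β) s v) =
      poch (m + s) m * poch (v + s) v * (poch (β + 1) (m + v) * (m + v).factorial) /
        (poch (s - β) m * poch (s - β) v * poch (s + 1) (2 * (m + v))) * Λ 1 := by
  have hd : (jacPoly (s - β) s m * jacPoly (s - β) s v).natDegree ≤ m + v :=
    natDegree_mul_le_of_le (natDegree_jacPoly_le m) (natDegree_jacPoly_le v)
  have he : ((-1 : ℝ) ^ m) ^ 2 = 1 := by rw [← pow_mul, mul_comm, pow_mul]; simp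
  have he' : ((-1 : ℝ) ^ v) ^ 2 = 1 := by rw [← pow_mul, mul_comm, pow_mul]; simp
  rw [mul_right_comm, hΛ.mul_eq_coeff hc hs hd, hΛ.X_pow_self hc hs,
    coeff_mul_add_eq_of_natDegree_le (natDegree_jacPoly_le m) (natDegree_jacPoly_le v),
    coeff_jacPoly, coeff_jacPoly, jacCoeff_self, jacCoeff_self, sub_sub_cancel, pow_add]
  simp only [div_eq_mul_inv, mul_inv]
  linear_combination (poch (m + s) m * poch (v + s) v * (poch (β + 1) (m + v) * (m + v).factorial) *
    ((poch (s - β) m)⁻¹ * (poch (s - β) v)⁻¹ * (poch (s + 1) (2 * (m + v)))⁻¹) * Λ 1) *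
      (((-1) ^ v) ^ 2 * he + he')

theorem IsJacobiFunctional.triple_pred_eq_zero (hΛ : IsJacobiFunctional (s - β) s Λ)
    (hc : ∀ j : ℕ, s - β + j ≠ 0) (hs : ∀ z : ℤ, s ≠ z) {m v : ℕ} (hv : v ≠ 0) :
    Λ (jacPoly (s - β) s m * jacPoly (s - β) s (m + v) * jacPoly (s - β) s (v - 1)) = 0 := by
  have hd : (jacPoly (s - β) s m * jacPoly (s - β) s (v - 1)).natDegree ≤ m + (v - 1) :=
    natDegree_mul_le_of_le (natDegree_jacPoly_le m) (natDegree_jacPoly_le (v - 1))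
  rw [mul_right_comm, hΛ.mul_eq_coeff hc hs (hd.trans (by omega)),
    coeff_eq_zero_of_natDegree_lt (by omega), zero_mul]

end TripleProduct

section TripleEvaluation

open Polynomial

variable {β s : ℝ} {Λ : ℝ[X] →ₗ[ℝ] ℝ}

theorem contigSum_zero (β s m v : ℝ) : contigSum β s m v 0 = 1 := by
  simp [contigSum, summandD, summandT, wellPoised, poch_zero]

/-- The three-term recurrence with the denominators of the outer coefficients made explicit. -/
theorem IsJacobiFunctional.triple_recurrence_cleared (hΛ : IsJacobiFunctional (s - β) s Λ)
    (hc : ∀ j : ℕ, s - β + j ≠ 0) (hs : ∀ z : ℤ, s ≠ z) (m v k : ℕ) :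
    (2 * (v + k) + s - 1) * ((v + k + s) * (v + k + s - β) * (k + 1) * (v + k + 1 + v) *
        (k + 1 + 2 * (m + v) + s) * (k + 1 - 2 * m - s)) / (v + k + 1) *
        Λ (jacPoly (s - β) s m * jacPoly (s - β) s (m + v) * jacPoly (s - β) s (v + k + 1)) +
      coefV β s m v (v + k) *
        Λ (jacPoly (s - β) s m * jacPoly (s - β) s (m + v) * jacPoly (s - β) s (v + k)) -
      (2 * (v + k) + s + 1) * ((v + k) * (v + k + β) * (k - 1 - 2 * m) * (s + 2 * v + k - 1) *
        (k - 1 + s) * (k - 1 + 2 * (m + v) + 2 * s)) / (v + k + s - 1) *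
        Λ (jacPoly (s - β) s m * jacPoly (s - β) s (m + v) * jacPoly (s - β) s (v + k - 1)) =
      0 := by
  have h := hΛ.triple_recurrence hc hs m (m + v) (v + k)
  obtain ⟨d0, d1, d2, d3, d4⟩ := denominators_ne_zero hs (v + k)
  have d5 : (v : ℝ) + k + 1 ≠ 0 := by positivity
  push_cast at h d0 d1 d2 d3 d4
  generalize Λ (jacPoly (s - β) s m * jacPoly (s - β) s (m + v) * jacPoly (s - β) s (v + k + 1)) =
    G1 at *
  generalize Λ (jacPoly (s - β) s m * jacPoly (s - β) s (m + v) * jacPoly (s - β) s (v + k)) =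
    G2 at *
  generalize Λ (jacPoly (s - β) s m * jacPoly (s - β) s (m + v) * jacPoly (s - β) s (v + k - 1)) =
    G3 at *
  have x1 : recA (s - β) s (v + k) / (v + k + 1) * bracketD s v k =
      -((2 * (v + k) + s - 1) * ((v + k + s) * (v + k + s - β)) / (v + k + 1)) := by
    unfold recA bracketD
    rw [mul_comm (v + k : ℝ) 2] at *
    generalize (v : ℝ) + k = l at *
    generalize 2 * l + s = x at *
    field_simp
    ring
  have x2 : midCoeff (s - β) s m (m + v) (v + k) * bracketD s v k = coefV β s m v (v + k) := by
    unfold midCoeff coefV bracketD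
    rw [mul_comm (v + k : ℝ) 2] at *
    generalize (v : ℝ) + k = l at *
    generalize 2 * l + s = x at *
    field_simp
  have x3 : -recC (s - β) s (v + k) / (v + k + s - 1) * bracketD s v k =
      (2 * (v + k) + s + 1) * ((v + k) * (v + k + β)) / (v + k + s - 1) := by
    unfold recC bracketD
    rw [mul_comm (v + k : ℝ) 2] at *
    generalize (v : ℝ) + k = l at *
    generalize 2 * l + s = x at *
    generalize l + s - 1 = y at *
    field_simp
    ring
  rw [show (v : ℝ) + k + 1 - (m + v - m) = k + 1 by ring,
    show (v : ℝ) + k + 1 + (m + v - m) = v + k + 1 + v by ring,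
    show (v : ℝ) + k + 1 + (m + v) + m + s = k + 1 + 2 * (m + v) + s by ring,
    show (v : ℝ) + k + 1 - (m + v) - m - s = k + 1 - 2 * m - s by ring,
    show (v : ℝ) + k - 1 - (m + v) - m = k - 1 - 2 * m by ring,
    show (v : ℝ) + k - 1 + (m + v - m) + s = s + 2 * v + k - 1 by ring,
    show (v : ℝ) + k - 1 - (m + v - m) + s = k - 1 + s by ring,
    show (v : ℝ) + k - 1 + (m + v) + m + 2 * s = k - 1 + 2 * (m + v) + 2 * s by ring] at h
  generalize recA (s - β) s (v + k) / (v + k + 1) = r1 at *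
  generalize midCoeff (s - β) s m (m + v) (v + k) = r2 at *
  generalize -recC (s - β) s (v + k) / (v + k + s - 1) = r3 at *
  generalize (v : ℝ) + k + 1 + v = y2 at *
  generalize (k : ℝ) + 1 + 2 * (m + v) + s = y3 at *
  generalize (k : ℝ) + 1 - 2 * m - s = y4 at *
  generalize (k : ℝ) + 1 = y1 at *
  generalize (k : ℝ) - 1 - 2 * m = z1 at *
  generalize s + 2 * v + (k : ℝ) - 1 = z2 at *
  generalize (k : ℝ) - 1 + s = z3 at *
  generalize (k : ℝ) - 1 + 2 * (m + v) + 2 * s = z4 at *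
  generalize (v : ℝ) + k + 1 = w1 at *
  generalize (v : ℝ) + k + s - 1 = w2 at *
  generalize 2 * ((v : ℝ) + k) + s - 1 = w3 at *
  generalize 2 * ((v : ℝ) + k) + s + 1 = w4 at *
  generalize (v : ℝ) + k + s - β = w5 at *
  generalize (v : ℝ) + k + s = w6 at *
  generalize (v : ℝ) + k + β = w7 at *
  generalize (v : ℝ) + k = w8 at *
  linear_combination bracketD s v k * h + y1 * y2 * y3 * y4 * G1 * x1 - G2 * x2 +
    z1 * z2 * z3 * z4 * G3 * x3

theorem prefactor_lower {β s m v k H0 H1 : ℝ} (t u : ℝ) (h : v + (k + 1) + s - 1 ≠ 0)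
    (hp : H1 * ((s - β + v + k) * (s + v + k) * (s + 2 * (m + v) + 1 + k) * (1 - s - 2 * m + k) *
          (k + 1) * (2 * β + 2 * v + 2 + k)) =
      H0 * ((v + 1 + k) * (β + 1 + v + k) * (2 * s + 2 * (m + v) + k) * (-2 * m + k) *
          (s - 1 - 2 * β + k) * (s + 2 * v + k))) :
    (2 * (v + (k + 1)) + s + 1) * ((v + (k + 1)) * (v + (k + 1) + β) * (k + 1 - 1 - 2 * m) *
        (s + 2 * v + (k + 1) - 1) * (k + 1 - 1 + s) * (k + 1 - 1 + 2 * (m + v) + 2 * s)) /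
        (v + (k + 1) + s - 1) * (t * H0 * u) *
        ((s + 2 * v + (k + 1) - 1) * (s - 1 - 2 * β + (k + 1) - 1)) =
      -(t * H1 * coefW β s m v (v + (k + 1)) *
        ((k + 1) * (2 * β + 2 * v + 2 + (k + 1) - 1)) * u) := by
  unfold coefW
  rw [div_mul_eq_mul_div, div_mul_eq_mul_div, div_eq_iff h]
  rw [show v + (k + 1) + s - 1 - β = s - β + v + k by ring,
    show s + (v + (k + 1)) + (m + v) + m = s + 2 * (m + v) + 1 + k by ring,
    show v + (k + 1) - s - (m + v) - m = 1 - s - 2 * m + k by ring,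
    show v + (k + 1) - 1 + v + s = s + 2 * v + k by ring,
    show v + (k + 1) - 1 - v + s = k + s by ring,
    show 2 * β + 2 * v + 2 + (k + 1) - 1 = 2 * β + 2 * v + 2 + k by ring,
    show v + (k + 1) + s - 1 = s + v + k by ring,
    show k + 1 - 1 - 2 * m = -2 * m + k by ring,
    show s + 2 * v + (k + 1) - 1 = s + 2 * v + k by ring,
    show k + 1 - 1 + s = k + s by ring,
    show k + 1 - 1 + 2 * (m + v) + 2 * s = 2 * s + 2 * (m + v) + k by ring,
    show s - 1 - 2 * β + (k + 1) - 1 = s - 1 - 2 * β + k by ring,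
    show v + (k + 1) + β = β + 1 + v + k by ring]
  rw [show v + (k + 1) = v + 1 + k by ring]
  generalize s - β + v + k = x1 at *
  generalize s + v + k = x2 at *
  generalize s + 2 * (m + v) + 1 + k = x3 at *
  generalize 1 - s - 2 * m + k = x4 at *
  generalize k + 1 = x5 at *
  generalize 2 * β + 2 * v + 2 + k = x6 at *
  generalize 2 * (v + 1 + k) + s + 1 = w at *
  generalize v + 1 + k = y1 at *
  generalize β + 1 + v + k = y2 at *
  generalize 2 * s + 2 * (m + v) + k = y3 at *
  generalize -2 * m + k = y4 at *
  generalize s - 1 - 2 * β + k = y5 at *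
  generalize s + 2 * v + k = y6 at *
  generalize k + s = z at *
  linear_combination (-w * y6 * z * t * u) * hp

theorem prefactor_upper {β s m v k H0 H1 : ℝ} (h : v + k + 1 ≠ 0)
    (hp : H1 * ((s - β + v + k) * (s + v + k) * (s + 2 * (m + v) + 1 + k) * (1 - s - 2 * m + k) *
          (k + 1) * (2 * β + 2 * v + 2 + k)) =
      H0 * ((v + 1 + k) * (β + 1 + v + k) * (2 * s + 2 * (m + v) + k) * (-2 * m + k) *
          (s - 1 - 2 * β + k) * (s + 2 * v + k))) :
    (2 * (v + k) + s - 1) * ((v + k + s) * (v + k + s - β) * (k + 1) * (v + k + 1 + v) *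
        (k + 1 + 2 * (m + v) + s) * (k + 1 - 2 * m - s)) / (v + k + 1) * H1 *
        ((k + 1) * (2 * β + 2 * v + 2 + k)) =
      H0 * coefU β s m v (v + k) * ((s - 1 - 2 * β + k) * (s + 2 * v + k)) := by
  unfold coefU
  rw [div_mul_eq_mul_div, div_mul_eq_mul_div, div_eq_iff h]
  rw [show v + k + s - β = s - β + v + k by ring, show v + k + s = s + v + k by ring,
    show k + 1 + 2 * (m + v) + s = s + 2 * (m + v) + 1 + k by ring,
    show k + 1 - 2 * m - s = 1 - s - 2 * m + k by ring,
    show v + k + β + 1 = β + 1 + v + k by ring,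
    show v + k + 1 - v = k + 1 by ring, show v + k + 1 + v = 2 * v + k + 1 by ring,
    show 2 * s + (v + k) + (m + v) + m = 2 * s + 2 * (m + v) + k by ring,
    show v + k - (m + v) - m = -2 * m + k by ring, show v + k + 1 = v + 1 + k by ring]
  generalize s - β + v + k = x1 at *
  generalize s + v + k = x2 at *
  generalize s + 2 * (m + v) + 1 + k = x3 at *
  generalize 1 - s - 2 * m + k = x4 at *
  generalize 2 * v + k + 1 = z at *
  generalize k + 1 = x5 at *
  generalize 2 * β + 2 * v + 2 + k = x6 at *
  generalize 2 * (v + k) + s - 1 = w at *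
  generalize v + 1 + k = y1 at *
  generalize β + 1 + v + k = y2 at *
  generalize 2 * s + 2 * (m + v) + k = y3 at *
  generalize -2 * m + k = y4 at *
  generalize s - 1 - 2 * β + k = y5 at *
  generalize s + 2 * v + k = y6 at *
  linear_combination (w * x5 * z) * hp

theorem IsJacobiFunctional.triple_eq (hΛ : IsJacobiFunctional (s - β) s Λ)
    (hc : ∀ j : ℕ, s - β + j ≠ 0) (hs : ∀ z : ℤ, s ≠ z) (he : ∀ z : ℤ, s - 1 - 2 * β ≠ z)
    (hβ : -1 < β) (hs1 : -1 < s) (m v : ℕ) {k : ℕ} (hk : k ≤ 2 * m) :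
    Λ (jacPoly (s - β) s m * jacPoly (s - β) s (m + v) * jacPoly (s - β) s (v + k)) =
      Λ (jacPoly (s - β) s m * jacPoly (s - β) s (m + v) * jacPoly (s - β) s v) *
        triplePrefactor β s m v k * contigSum β s m v k := by
  induction k using Nat.strong_induction_on with
  | _ k ih =>
  rcases k with _ | k
  · simp [triplePrefactor, poch_zero, contigSum_zero]
  have hv0 : (0 : ℝ) ≤ v := by positivity
  have hk0 : (0 : ℝ) ≤ k := by positivity
  have hm : (1 : ℝ) ≤ m := by
    have : 1 ≤ m := by omega
    exact_mod_cast this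
  have hrec := hΛ.triple_recurrence_cleared hc hs m v k
  have hS := contigSum_recurrence (β := β) (s := s) (m := m) (v := v) (k := k)
    (fun i => by positivity)
    (fun i h => by
      have h' : ((1 + 2 * i : ℕ) : ℝ) = ((2 * m : ℕ) : ℝ) := by push_cast; linarith
      have := Nat.cast_injective h'
      omega)
    (fun i => by have : (0 : ℝ) ≤ i := by positivity
                 intro h; linarith)
    (fun i h => by
      have := add_intCast_ne_zero he (k - i)
      push_cast at this
      apply this
      linarith)
    (fun i => by have : (0 : ℝ) ≤ i := by positivity
                 intro h; linarith)
  have hp := triplePrefactor_succ hβ hc hs m v k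
  have ik := ih k (by omega) (by omega)
  have n1 : s - β + v + k ≠ 0 := by
    have := hc (v + k); push_cast at this; rwa [← add_assoc] at this
  have n2 : s + v + k ≠ 0 := by
    have := add_intCast_ne_zero hs (v + k); push_cast at this; rwa [← add_assoc] at this
  have n3 : s + 2 * (m + v) + 1 + k ≠ 0 := by
    have := add_intCast_ne_zero hs (2 * (m + v) + 1 + k); push_cast at this
    intro h; apply this; linarith
  have n4 : 1 - s - 2 * m + k ≠ 0 := by
    have := add_intCast_ne_zero hs (2 * m - 1 - k); push_cast at this
    intro h; apply this; linarith
  have n5 : (k : ℝ) + 1 ≠ 0 := by positivity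
  have n6 : 2 * β + 2 * v + 2 + k ≠ 0 := by intro h; linarith
  have n7 : s + 2 * v + k - 1 ≠ 0 := by
    have := add_intCast_ne_zero hs (2 * v + k - 1); push_cast at this
    intro h; apply this; linarith
  have n8 : s - 1 - 2 * β + k - 1 ≠ 0 := by
    have := add_intCast_ne_zero he (k - 1); push_cast at this
    intro h; apply this; linarith
  have n9 : (v : ℝ) + k + 1 ≠ 0 := by positivity
  have n10 : (v : ℝ) + k + 1 + v ≠ 0 := by positivity
  have n11 : 2 * ((v : ℝ) + k) + s - 1 ≠ 0 := by
    have := add_intCast_ne_zero hs (2 * (v + k) - 1); push_cast at this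
    intro h; apply this; linarith
  have n12 : (v : ℝ) + k + s - 1 ≠ 0 := by
    have := add_intCast_ne_zero hs (v + k - 1); push_cast at this
    intro h; apply this; linarith
  set G0 := Λ (jacPoly (s - β) s m * jacPoly (s - β) s (m + v) * jacPoly (s - β) s v)
  have hlow : (2 * (v + k) + s + 1) * ((v + k) * (v + k + β) * (k - 1 - 2 * m) *
        (s + 2 * v + k - 1) * (k - 1 + s) * (k - 1 + 2 * (m + v) + 2 * s)) / (v + k + s - 1) *
        Λ (jacPoly (s - β) s m * jacPoly (s - β) s (m + v) * jacPoly (s - β) s (v + k - 1)) *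
        ((s + 2 * v + k - 1) * (s - 1 - 2 * β + k - 1)) =
      -(G0 * triplePrefactor β s m v k * coefW β s m v (v + k) * (k *
        (2 * β + 2 * v + 2 + k - 1)) * contigSum β s m v (k - 1)) := by
    rcases k with _ | k
    · rcases v with _ | v
      · simp
      · rw [add_zero, hΛ.triple_pred_eq_zero hc hs (by omega)]
        simp
    · have hp := triplePrefactor_succ hβ hc hs m v k
      rw [← add_assoc, Nat.add_sub_cancel, Nat.add_sub_cancel, ih k (by omega) (by omega)]
      push_cast at n12 ⊢
      exact prefactor_lower _ _ n12 hp
  have hup := prefactor_upper n9 hp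
  have ne : (2 * (v + k) + s - 1) * ((v + k + s) * (v + k + s - β) * (k + 1) * (v + k + 1 + v) *
        (k + 1 + 2 * (m + v) + s) * (k + 1 - 2 * m - s)) / (v + k + 1) *
      ((s + 2 * v + k - 1) * (s - 1 - 2 * β + k - 1) *
        ((k + 1) * (2 * β + 2 * v + 2 + k))) ≠ 0 := by
    have m1 : (v : ℝ) + k + s ≠ 0 := by intro h; apply n2; linarith
    have m2 : (v : ℝ) + k + s - β ≠ 0 := by intro h; apply n1; linarith
    have m3 : k + 1 + 2 * (m + v) + s ≠ 0 := by intro h; apply n3; linarith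
    have m4 : k + 1 - 2 * m - s ≠ 0 := by intro h; apply n4; linarith
    exact mul_ne_zero (div_ne_zero (mul_ne_zero n11 (mul_ne_zero (mul_ne_zero (mul_ne_zero
      (mul_ne_zero (mul_ne_zero m1 m2) n5) n10) m3) m4)) n9)
      (mul_ne_zero (mul_ne_zero n7 n8) (mul_ne_zero n5 n6))
  refine mul_left_cancel₀ ne ?_
  rw [← add_assoc]
  rw [ik] at hrec
  clear ne ih ik hp
  generalize Λ (jacPoly (s - β) s m * jacPoly (s - β) s (m + v) * jacPoly (s - β) s (v + k + 1)) =
    G1 at *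
  generalize Λ (jacPoly (s - β) s m * jacPoly (s - β) s (m + v) * jacPoly (s - β) s (v + k - 1)) =
    G3 at *
  generalize (2 * (v + k) + s + 1) * ((v + k) * (v + k + β) * (k - 1 - 2 * m) *
    (s + 2 * v + k - 1) * (k - 1 + s) * (k - 1 + 2 * (m + v) + 2 * s)) / (v + k + s - 1) = C3 at *
  generalize (2 * (v + k) + s - 1) * ((v + k + s) * (v + k + s - β) * (k + 1) * (v + k + 1 + v) *
    (k + 1 + 2 * (m + v) + s) * (k + 1 - 2 * m - s)) / (v + k + 1) = C1 at *
  generalize coefU β s m v (v + k) = cU at *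
  generalize coefV β s m v (v + k) = cV at *
  generalize coefW β s m v (v + k) = cW at *
  generalize s + 2 * v + (k : ℝ) - 1 = a0 at *
  generalize s - 1 - 2 * β + (k : ℝ) - 1 = e0 at *
  generalize 2 * β + 2 * v + 2 + (k : ℝ) - 1 = b0 at *
  generalize s + 2 * v + (k : ℝ) = a1 at *
  generalize s - 1 - 2 * β + (k : ℝ) = e1 at *
  generalize 2 * β + 2 * v + 2 + (k : ℝ) = b1 at *
  generalize (k : ℝ) + 1 = k1 at *
  linear_combination (a0 * e0 * (k1 * b1)) * hrec + k1 * b1 * hlow -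
    G0 * triplePrefactor β s m v k * hS - G0 * contigSum β s m v (k + 1) * a0 * e0 * hup

end TripleEvaluation

section Integral

open Polynomial

variable {α β : ℝ}

theorem intervalIntegrable_jacobiWeight (hα : -1 < α) (hβ : -1 < β) :
    IntervalIntegrable (fun x : ℝ => (1 - x) ^ α * (1 + x) ^ β) volume (-1) 1 := by
  have h1 : IntervalIntegrable (fun x : ℝ => (1 + x) ^ β) volume (-1) 0 := by
    have h : IntervalIntegrable (fun x : ℝ => x ^ β) volume 0 1 :=
      intervalIntegral.intervalIntegrable_rpow' hβ
    simpa using h.comp_add_left 1 (by simp)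
  have h2 : IntervalIntegrable (fun x : ℝ => (1 - x) ^ α) volume 0 1 := by
    have h : IntervalIntegrable (fun x : ℝ => x ^ α) volume 1 0 :=
      intervalIntegral.intervalIntegrable_rpow' hα
    simpa using h.comp_sub_left 1 (by simp)
  refine IntervalIntegrable.trans (b := 0) (h1.continuousOn_mul ?_) (h2.mul_continuousOn ?_)
  · intro x hx
    rw [Set.uIcc_of_le (by norm_num)] at hx
    exact (ContinuousAt.rpow_const (by fun_prop)
      (Or.inl (by linarith [hx.2]))).continuousWithinAt
  · intro x hx
    rw [Set.uIcc_of_le (by norm_num)] at hx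
    exact (ContinuousAt.rpow_const (by fun_prop) (Or.inl (by linarith [hx.1]))).continuousWithinAt

theorem intervalIntegrable_eval_mul_jacobiWeight (hα : -1 < α) (hβ : -1 < β) (p : ℝ[X]) :
    IntervalIntegrable (fun x : ℝ => p.eval ((1 - x) / 2) * ((1 - x) ^ α * (1 + x) ^ β))
      volume (-1) 1 :=
  (intervalIntegrable_jacobiWeight hα hβ).continuousOn_mul (by fun_prop)

/-- Integration against the Jacobi weight, in the variable `(1 - x) / 2`. -/
noncomputable def jacobiIntegral (hα : -1 < α) (hβ : -1 < β) : ℝ[X] →ₗ[ℝ] ℝ where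
  toFun p := ∫ x in (-1 : ℝ)..1, p.eval ((1 - x) / 2) * ((1 - x) ^ α * (1 + x) ^ β)
  map_add' p q := by
    rw [← intervalIntegral.integral_add (intervalIntegrable_eval_mul_jacobiWeight hα hβ p)
      (intervalIntegrable_eval_mul_jacobiWeight hα hβ q)]
    simp only [eval_add, add_mul]
  map_smul' a p := by
    rw [RingHom.id_apply, smul_eq_mul, ← intervalIntegral.integral_const_mul]
    simp only [eval_smul, smul_eq_mul, mul_assoc]

theorem isJacobiFunctional_jacobiIntegral (hα : -1 < α) (hβ : -1 < β) :
    IsJacobiFunctional (α + 1) (α + β + 1) (jacobiIntegral hα hβ) := by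
  intro g
  set q := X * (1 - X) * derivative g + (C (α + 1) - C (α + β + 1 + 1) * X) * g with hq
  have key : ∀ x ∈ Set.Ioo (-1 : ℝ) 1,
      HasDerivAt (fun x : ℝ => g.eval ((1 - x) / 2) * ((1 - x) ^ (α + 1) * (1 + x) ^ (β + 1)))
        (-2 * (q.eval ((1 - x) / 2) * ((1 - x) ^ α * (1 + x) ^ β))) x := by
    intro x hx
    have p1 : 0 < 1 - x := by linarith [hx.2]
    have p2 : 0 < 1 + x := by linarith [hx.1]
    have d0 : HasDerivAt (fun x : ℝ => 1 - x) (-1) x := by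
      simpa using (hasDerivAt_id x).const_sub 1
    have d0' : HasDerivAt (fun x : ℝ => 1 + x) 1 x := by
      simpa using (hasDerivAt_id x).const_add 1
    have d1 := (g.hasDerivAt ((1 - x) / 2)).comp x (d0.div_const 2)
    have d2 := d0.rpow_const (p := α + 1) (Or.inl p1.ne')
    have d3 := d0'.rpow_const (p := β + 1) (Or.inl p2.ne')
    refine (d1.mul (d2.mul d3)).congr_deriv ?_
    simp only [hq, eval_add, eval_mul, eval_sub, eval_X, eval_one, eval_C, add_sub_cancel_right,
      Function.comp_apply, Real.rpow_add_one p1.ne', Real.rpow_add_one p2.ne', Pi.mul_apply]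
    ring
  have hc : ContinuousOn
      (fun x : ℝ => g.eval ((1 - x) / 2) * ((1 - x) ^ (α + 1) * (1 + x) ^ (β + 1)))
      (Set.Icc (-1) 1) := by
    refine Continuous.continuousOn (Continuous.mul (by fun_prop) (Continuous.mul ?_ ?_))
    · exact (Continuous.sub continuous_const continuous_id).rpow_const fun x => Or.inr (by linarith)
    · exact (Continuous.add continuous_const continuous_id).rpow_const fun x => Or.inr (by linarith)
  have h := intervalIntegral.integral_eq_sub_of_hasDerivAt_of_le (by norm_num) hc key
    ((intervalIntegrable_eval_mul_jacobiWeight hα hβ q).const_mul (-2))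
  rw [intervalIntegral.integral_const_mul] at h
  have z1 : (0 : ℝ) ^ (α + 1) = 0 := Real.zero_rpow (by linarith)
  have z2 : (0 : ℝ) ^ (β + 1) = 0 := Real.zero_rpow (by linarith)
  simp only [sub_self, z1, add_neg_cancel, z2, mul_zero, zero_mul] at h
  change (∫ x in (-1 : ℝ)..1, q.eval ((1 - x) / 2) * ((1 - x) ^ α * (1 + x) ^ β)) = 0
  linarith

theorem integral_jacobiWeight (hα : -1 < α) (hβ : -1 < β) :
    ∫ x in (-1 : ℝ)..1, (1 - x) ^ α * (1 + x) ^ β =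
      2 ^ (α + β + 1) * (Real.Gamma (α + 1) * Real.Gamma (β + 1) / Real.Gamma (α + β + 2)) := by
  have hB : ∫ x in (0 : ℝ)..1, x ^ α * (1 - x) ^ β =
      Real.Gamma (α + 1) * Real.Gamma (β + 1) / Real.Gamma (α + β + 2) := by
    have h := Complex.betaIntegral_eq_Gamma_mul_div ((α + 1 : ℝ) : ℂ) ((β + 1 : ℝ) : ℂ)
      (by simpa using by linarith) (by simpa using by linarith)
    rw [← Complex.ofReal_add, Complex.Gamma_ofReal, Complex.Gamma_ofReal, Complex.Gamma_ofReal,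
      Complex.betaIntegral, show α + 1 + (β + 1) = α + β + 2 by ring] at h
    have e : ∫ x in (0 : ℝ)..1, (x : ℂ) ^ (((α + 1 : ℝ) : ℂ) - 1) *
        (1 - (x : ℂ)) ^ (((β + 1 : ℝ) : ℂ) - 1) =
        ((∫ x in (0 : ℝ)..1, x ^ α * (1 - x) ^ β : ℝ) : ℂ) := by
      rw [← intervalIntegral.integral_ofReal]
      refine intervalIntegral.integral_congr fun x hx => ?_
      rw [Set.uIcc_of_le zero_le_one] at hx
      simp only [Complex.ofReal_mul]
      rw [Complex.ofReal_cpow hx.1, Complex.ofReal_cpow (by linarith [hx.2])]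
      push_cast
      simp
    rw [e] at h
    exact_mod_cast h
  rw [← hB]
  have h := intervalIntegral.integral_comp_sub_mul (a := (-1 : ℝ)) (b := 1)
    (fun x : ℝ => x ^ α * (1 - x) ^ β) (c := 1 / 2) (by norm_num) (1 / 2)
  norm_num at h
  have h2 : ∫ x in (-1 : ℝ)..1, (1 - x) ^ α * (1 + x) ^ β =
      2 ^ (α + β) * ∫ x in (-1 : ℝ)..1, (1 / 2 - 1 / 2 * x) ^ α * (1 - (1 / 2 - 1 / 2 * x)) ^ β :=
          by
    rw [← intervalIntegral.integral_const_mul]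
    refine intervalIntegral.integral_congr fun x hx => ?_
    rw [Set.uIcc_of_le (by norm_num)] at hx
    have p1 : 0 ≤ (1 / 2 - 1 / 2 * x) := by linarith [hx.2]
    have p2 : 0 ≤ (1 - (1 / 2 - 1 / 2 * x)) := by linarith [hx.1]
    rw [show 1 - x = 2 * (1 / 2 - 1 / 2 * x) by ring,
      show 1 + x = 2 * (1 - (1 / 2 - 1 / 2 * x)) by ring, Real.mul_rpow zero_le_two p1,
      Real.mul_rpow zero_le_two p2, Real.rpow_add zero_lt_two]
    ring
  rw [h2, h, Real.rpow_add_one two_ne_zero]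
  ring

end Integral

section Rahman

open Polynomial

theorem pochZ_natCast (a : ℝ) (j : ℕ) : pochZ a j = poch a j := by simp [pochZ]

theorem ifact_natCast (j : ℕ) : ifact j = j.factorial := by simp [ifact]

theorem jacobiP_eq (α β : ℝ) (n : ℕ) (x : ℝ) :
    jacobiP α β n x = poch (α + 1) n / n.factorial *
      (jacPoly (α + 1) (α + β + 1) n).eval ((1 - x) / 2) := by
  simp only [jacobiP, jacPoly, eval_finsetSum, eval_monomial, jacCoeff, ← add_assoc]

theorem integral_jacobiP_mul_jacobiP_mul_jacobiP {α β : ℝ} (hα : -1 < α) (hβ : -1 < β)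
    (m n l : ℕ) :
    ∫ x in (-1 : ℝ)..1, jacobiP α β m x * jacobiP α β n x * jacobiP α β l x *
        ((1 - x) ^ α * (1 + x) ^ β) =
      poch (α + 1) m / m.factorial * (poch (α + 1) n / n.factorial) *
        (poch (α + 1) l / l.factorial) *
        jacobiIntegral hα hβ (jacPoly (α + 1) (α + β + 1) m * jacPoly (α + 1) (α + β + 1) n *
          jacPoly (α + 1) (α + β + 1) l) := by
  simp only [jacobiIntegral, LinearMap.coe_mk, AddHom.coe_mk,
    ← intervalIntegral.integral_const_mul, jacobiP_eq, eval_mul]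
  congr 1
  ext x
  ring

theorem aRah_eq {α β : ℝ} (hβ : -1 < β) (m v k : ℕ) :
    aRah α β k (m + v : ℕ) m =
      poch (α + 1) (m + v) * poch (β + 1) (m + v) * poch (α + β + 1) (2 * v) *
          poch (α + β + 1) (2 * m) * (2 * (v + k) + α + β + 1) /
        (m.factorial * poch (α + β + 1) m * poch (α + 1) v * poch (β + 1) v *
          poch (α + β + 2) (2 * (m + v)) * (α + β + 1)) *
      ((poch (v + 1) k * poch (α + β + 1 + 2 * v) k * poch (2 * (α + β + 1) + 2 * (m + v)) k *
          poch (-2 * m) k * poch (α - β) k) /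
        (k.factorial * poch (2 * β + 2 * v + 2) k * poch (α + 1 + v) k *
          poch (α + β + 1 + 2 * (m + v) + 1) k * poch (1 - (α + β + 1) - 2 * m) k)) *
      contigSum β (α + β + 1) m v k := by
  have z1 : 2 * ((m + v : ℕ) : ℤ) - 2 * (m : ℤ) = ((2 * v : ℕ) : ℤ) := by push_cast; ring
  have z2 : 2 * (m : ℤ) = ((2 * m : ℕ) : ℤ) := by push_cast; ring
  have z3 : ((m + v : ℕ) : ℤ) - (m : ℤ) = (v : ℤ) := by push_cast; ring
  have z4 : 2 * ((m + v : ℕ) : ℤ) = ((2 * (m + v) : ℕ) : ℤ) := by push_cast; ring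
  simp only [aRah, Int.cast_natCast]
  rw [hypSum_eq_contigSum hβ, z1, z2, z3, z4]
  simp only [pochZ_natCast, ifact_natCast]
  rw [show ((m + v : ℕ) : ℝ) = m + v by push_cast; ring]
  rw [show α + β + 1 + 2 * ((m : ℝ) + v) - 2 * m + 2 * k = 2 * (v + k) + α + β + 1 by ring,
    show (m : ℝ) + v - m + 1 = v + 1 by ring,
    show α + β + 2 * ((m : ℝ) + v) - 2 * m + 1 = α + β + 1 + 2 * v by ring,
    show 2 * α + 2 * β + 2 * ((m : ℝ) + v) + 2 = 2 * (α + β + 1) + 2 * (m + v) by ring,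
    show 2 * β + 2 * ((m : ℝ) + v) - 2 * m + 2 = 2 * β + 2 * v + 2 by ring,
    show α + ((m : ℝ) + v) - m + 1 = α + 1 + v by ring,
    show α + β + 2 * ((m : ℝ) + v) + 2 = α + β + 1 + 2 * (m + v) + 1 by ring,
    show -α - β - 2 * (m : ℝ) = 1 - (α + β + 1) - 2 * m by ring]

theorem Gamma_factor_eq {α β : ℝ} (hα : -1 < α) (hβ : -1 < β)
    (hs : ∀ z : ℤ, α + β + 1 ≠ z) (l : ℕ) :
    2 ^ (α + β + 1) * Real.Gamma (l + α + 1) * Real.Gamma (l + β + 1) /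
        ((2 * l + α + β + 1) * Real.Gamma (l + α + β + 1) * l.factorial) =
      (2 ^ (α + β + 1) * (Real.Gamma (α + 1) * Real.Gamma (β + 1) / Real.Gamma (α + β + 2))) *
        (poch (α + 1) l * poch (β + 1) l * (α + β + 1) /
          ((2 * l + α + β + 1) * poch (α + β + 1) l * l.factorial)) := by
  have hs' (i : ℕ) : α + β + 1 + i ≠ 0 := by exact_mod_cast add_intCast_ne_zero hs i
  have hp {a : ℝ} (h : -1 < a) (i : ℕ) : a + 1 + i ≠ 0 := by
    have : (0 : ℝ) ≤ i := i.cast_nonneg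
    intro h'; linarith
  have g1 := Gamma_nat_add (α + 1) (hp hα) l
  have g2 := Gamma_nat_add (β + 1) (hp hβ) l
  have g3 := Gamma_nat_add (α + β + 1) hs' l
  have s0 : α + β + 1 ≠ 0 := by simpa using hs' 0
  have g4 : Real.Gamma (α + β + 2) = (α + β + 1) * Real.Gamma (α + β + 1) := by
    rw [← Real.Gamma_add_one s0]; congr 1; ring
  rw [← add_assoc] at g1 g2
  rw [← add_assoc, ← add_assoc] at g3
  rw [g1, g2, g3, g4]
  simp only [div_eq_mul_inv, mul_inv]
  linear_combination (-(2 ^ (α + β + 1) * (poch (α + 1) l * Real.Gamma (α + 1)) *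
    (poch (β + 1) l * Real.Gamma (β + 1)) * ((2 * l + α + β + 1)⁻¹ *
      ((poch (α + β + 1) l)⁻¹ * (Real.Gamma (α + β + 1))⁻¹) * (l.factorial : ℝ)⁻¹))) *
    (mul_inv_cancel₀ s0)

end Rahman

theorem stmt12 (m n l : ℕ) (hmn : m ≤ n) (hl1 : n - m ≤ l) (hl2 : l ≤ n + m)
    (α β : ℝ) (hα : -1 < α) (hβ : -1 < β)
    (hd : ∀ z : ℤ, α - β ≠ (z : ℝ)) (hs : ∀ z : ℤ, α + β ≠ (z : ℝ)) :
    (∫ x in (-1 : ℝ)..1,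
        jacobiP α β m x * jacobiP α β n x * jacobiP α β l x *
          ((1 - x) ^ α * (1 + x) ^ β)) =
      aRah α β ((l : ℤ) + m - n) (n : ℤ) (m : ℤ) *
        ((2 : ℝ) ^ (α + β + 1) * Real.Gamma ((l : ℝ) + α + 1) *
            Real.Gamma ((l : ℝ) + β + 1) /
          ((2 * (l : ℝ) + α + β + 1) * Real.Gamma ((l : ℝ) + α + β + 1) * l.factorial)) := by
  obtain ⟨v, rfl⟩ := Nat.exists_eq_add_of_le hmn
  obtain ⟨k, rfl⟩ := Nat.exists_eq_add_of_le (show v ≤ l by omega)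
  have hk : k ≤ 2 * m := by omega
  have hs' (z : ℤ) : α + β + 1 ≠ z := fun h => hs (z - 1) (by push_cast; linarith)
  have hα' (j : ℕ) : α + 1 + j ≠ 0 := by
    have : (0 : ℝ) ≤ j := j.cast_nonneg
    intro h; linarith
  have hβ' (j : ℕ) : β + 1 + j ≠ 0 := by
    have : (0 : ℝ) ≤ j := j.cast_nonneg
    intro h; linarith
  have hsj (j : ℕ) : α + β + 1 + j ≠ 0 := by exact_mod_cast add_intCast_ne_zero hs' j
  have hc : α + β + 1 - β = α + 1 := by ring
  have hΛ := isJacobiFunctional_jacobiIntegral hα hβ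
  have hΛ1 : jacobiIntegral hα hβ 1 = 2 ^ (α + β + 1) *
      (Real.Gamma (α + 1) * Real.Gamma (β + 1) / Real.Gamma (α + β + 2)) := by
    rw [← integral_jacobiWeight hα hβ]
    simp [jacobiIntegral]
  rw [← hc] at hΛ
  have h1 := hΛ.triple_eq (by rwa [hc]) hs' (fun z h => hd z (by linarith)) hβ
    (by linarith) m v hk
  have h0 := hΛ.triple_zero (by rwa [hc]) hs' m v
  rw [show ((v + k : ℕ) : ℤ) + m - (m + v : ℕ) = k by push_cast; ring, aRah_eq hβ,
    Gamma_factor_eq hα hβ hs', integral_jacobiP_mul_jacobiP_mul_jacobiP hα hβ]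
  rw [hc] at h0 h1
  rw [h1, h0, hΛ1, triplePrefactor, hc]
  rw [show α + β + 1 - 1 - 2 * β = α - β by ring, show α + β + 1 + 1 = α + β + 2 by ring]
  have e1 : poch (α + β + 1) (2 * m) = poch (α + β + 1) m * poch (m + (α + β + 1)) m := by
    rw [two_mul, poch_add, add_comm (m : ℝ)]
  have e2 : poch (α + β + 1) (2 * v) = poch (α + β + 1) v * poch (v + (α + β + 1)) v := by
    rw [two_mul, poch_add, add_comm (v : ℝ)]
  have n1 := poch_ne_zero hα' m
  have n2 := poch_ne_zero hβ' v
  have n3 := poch_ne_zero hsj m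
  have n4 := poch_ne_zero hsj v
  have n6 : α + β + 1 ≠ 0 := by simpa using hsj 0
  have n7 : 2 * ((v : ℝ) + k) + α + β + 1 ≠ 0 := by
    have := hsj (2 * (v + k)); push_cast at this; intro h; apply this; linarith
  have n9 : ((m + v).factorial : ℝ) ≠ 0 := by positivity
  rw [e1, e2, poch_add (β + 1) v, poch_add (α + β + 1) v k, Nat.cast_add v k]
  generalize 2 * ((v : ℝ) + k) + α + β + 1 = y at *
  generalize poch (α + 1) (v + k) = y1
  generalize poch (α + 1) (m + v) = y2
  generalize poch (β + 1) (m + v) = y3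
  generalize poch (α + β + 1 + v) k = y4 at *
  generalize poch (α + β + 1) v = y5 at *
  generalize poch (α + β + 1) m = y6 at *
  generalize poch (β + 1) v = y7 at *
  generalize poch (α + 1) m = y8 at *
  generalize α + β + 1 = y9 at *
  clear h1 h0 hΛ1 hc hΛ e1 e2 hs' hsj
  generalize contigSum β y9 m v k = z1
  generalize (2 : ℝ) ^ y9 * (Real.Gamma (α + 1) * Real.Gamma (β + 1) /
    Real.Gamma (α + β + 2)) = z2
  generalize poch (m + y9) m = z3
  generalize poch (v + y9) v = z4
  generalize poch (α + 1) v = z5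
  generalize poch (α + β + 2) (2 * (m + v)) = z6
  generalize poch (v + 1) k = z7
  generalize poch (β + 1 + v) k = z8
  generalize poch (2 * y9 + 2 * (m + v)) k = z9
  generalize poch (-2 * m) k = z10
  generalize poch (α - β) k = z11
  generalize poch (y9 + 2 * v) k = z12
  generalize poch (α + 1 + v) k = z13
  generalize poch (y9 + 2 * (m + v) + 1) k = z14
  generalize poch (1 - y9 - 2 * m) k = z15
  generalize poch (2 * β + 2 * v + 2) k = z16
  generalize (m.factorial : ℝ) = z17 at *
  generalize ((m + v).factorial : ℝ) = z18 at *
  generalize ((v + k).factorial : ℝ) = z19 at *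
  generalize (k.factorial : ℝ) = z20 at *
  simp only [div_eq_mul_inv, mul_inv]
  generalize z17⁻¹ = w17
  generalize z5⁻¹ = w5
  generalize z6⁻¹ = w6
  generalize z13⁻¹ = w13
  generalize z14⁻¹ = w14
  generalize z15⁻¹ = w15
  generalize z16⁻¹ = w16
  generalize z19⁻¹ = w19
  generalize z20⁻¹ = w20
  have c5 := mul_inv_cancel₀ n4
  have c6 := mul_inv_cancel₀ n3
  have c7 := mul_inv_cancel₀ n2
  have c8 := mul_inv_cancel₀ n1
  have c9 := mul_inv_cancel₀ n6
  have c10 := mul_inv_cancel₀ n7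
  have c18 := mul_inv_cancel₀ n9
  generalize y4⁻¹ = w4
  generalize y5⁻¹ = v5 at *
  generalize y6⁻¹ = v6 at *
  generalize y7⁻¹ = v7 at *
  generalize y8⁻¹ = v8 at *
  generalize y9⁻¹ = v9 at *
  generalize y⁻¹ = v10 at *
  generalize z18⁻¹ = v18 at *
  trans y2 * y1 * y3 * z1 * z2 * z3 * z4 * z7 * z8 * z9 * z10 * z11 * z12 * w5 * w6 * w13 * w14 *
    w15 * w16 * w17 * w19 * w20 * w4 * ((y8 * v8) * (z18 * v18))
  · ring
  trans y2 * y1 * y3 * z1 * z2 * z3 * z4 * z7 * z8 * z9 * z10 * z11 * z12 * w5 * w6 * w13 * w14 *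
    w15 * w16 * w17 * w19 * w20 * w4 *
    ((y5 * v5) * (y6 * v6) * (y7 * v7) * (y9 * v9) * (y * v10))
  · rw [c5, c6, c7, c8, c9, c10, c18]; simp only [mul_one]
  · ring
end

section
/- Let m, n ∈ ℕ with n ≥ m, let α ∈ ℝ with α > −1, and let x ∈ ℝ. Then the product of two Laguerre polynomials linearizes as L_m^α(x)·L_n^α(x) = [2^{2m}·(1/2)_m·(α+1)_n/(n−m)!] · Σ_{k=n−m}^{n+m} [(−1)^{k+n+m}·k!/((α+1)_k·(m+n−k)!·(k−n+m)!)] · ₃F₂(−m−α, (n−m−k)/2, (n−m−k+1)/2; n−m+1, 1/2−m; 1) · L_k^α(x). -/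
open MeasureTheory

/-- Laguerre polynomial `L_n^α(x)`. -/
noncomputable def lagL (α : ℝ) (n : ℕ) (x : ℝ) : ℝ :=
  ∑ k ∈ Finset.range (n + 1),
    (-1) ^ k * poch (α + k + 1) (n - k) / (((n - k).factorial : ℝ) * k.factorial) * x ^ k

theorem poch_pos {a : ℝ} (ha : 0 < a) (j : ℕ) : 0 < poch a j :=
  ascPochhammer_pos j a ha

/-- Reflection of the Pochhammer symbol. -/
theorem poch_reflect (c : ℝ) (r j : ℕ) :
    poch (1 - c - (r + j : ℕ)) j * poch c r = (-1) ^ j * poch c (r + j) := by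
  induction j with
  | zero => simp [poch_zero]
  | succ j ih =>
    rw [poch_succ_left, ← add_assoc, poch_succ, pow_succ,
      show 1 - c - ((r + j + 1 : ℕ) : ℝ) + 1 = 1 - c - (r + j : ℕ) by push_cast; ring,
      mul_assoc, ih]
    push_cast
    ring

theorem poch_half_mul_factorial (r : ℕ) :
    2 ^ (2 * r) * poch (1 / 2) r * (r.factorial : ℝ) = ((2 * r).factorial : ℝ) := by
  induction r with
  | zero => simp [poch_zero]
  | succ r ih =>
    rw [show 2 * (r + 1) = 2 * r + 1 + 1 by ring, Nat.factorial_succ (2 * r + 1),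
      Nat.factorial_succ (2 * r), Nat.factorial_succ r, poch_succ]
    push_cast
    rw [← ih]
    ring

theorem poch_natCast_add_one_mul_factorial (d j : ℕ) :
    poch ((d : ℝ) + 1) j * (d.factorial : ℝ) = ((d + j).factorial : ℝ) := by
  induction j with
  | zero => simp [poch_zero]
  | succ j ih =>
    rw [poch_succ, ← add_assoc, Nat.factorial_succ]
    push_cast
    rw [← ih]
    ring

theorem cast_descFactorial_succ (i j : ℕ) :
    (i.descFactorial (j + 1) : ℝ) = ((i : ℝ) - j) * i.descFactorial j := by
  rw [Nat.descFactorial_succ]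
  rcases le_or_gt j i with h | h
  · push_cast [Nat.cast_sub h]; ring
  · simp [Nat.descFactorial_of_lt h]

/-- Duplication: `(-i/2)_j ((1-i)/2)_j` is a falling factorial. -/
theorem poch_neg_half_mul (i j : ℕ) :
    poch (-(i : ℝ) / 2) j * poch ((-(i : ℝ) + 1) / 2) j
      = (i.descFactorial (2 * j) : ℝ) / 2 ^ (2 * j) := by
  induction j with
  | zero => simp [poch_zero]
  | succ j ih =>
    rw [poch_succ, poch_succ, show 2 * (j + 1) = 2 * j + 1 + 1 by ring,
      cast_descFactorial_succ, cast_descFactorial_succ, mul_mul_mul_comm, ih]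
    push_cast
    field_simp
    ring

/-- Chu–Vandermonde for rising factorials. -/
theorem poch_add_natCast (c : ℝ) (a b : ℕ) :
    poch (c + a) b
      = ∑ r ∈ Finset.range (b + 1),
          (b.choose r : ℝ) * (a.descFactorial r * poch (c + r) (b - r)) := by
  induction b generalizing c with
  | zero => simp [poch_zero]
  | succ b ih =>
    rw [Finset.sum_choose_succ_mul (fun r q => (a.descFactorial r : ℝ) * poch (c + r) q) b,
      poch_succ_left, show c + a + 1 = (c + 1) + a by ring, ih, Finset.mul_sum,
      ← Finset.sum_add_distrib]
    refine Finset.sum_congr rfl fun r hr => ?_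
    have hr' : r ≤ b := by simpa [Nat.lt_succ_iff] using hr
    rw [Nat.succ_sub hr', poch_succ_left, cast_descFactorial_succ,
      show c + 1 + (r : ℝ) = c + r + 1 by ring]
    push_cast
    rw [← add_assoc]
    ring

theorem inv_poch_mul_inv_poch {c : ℝ} (hc : 0 < c) {m a : ℕ} (ham : a ≤ m) (b : ℕ) :
    1 / (poch c a * poch c b)
      = ∑ r ∈ Finset.range (m + 1),
          (a.choose r : ℝ) * b.choose r * (r.factorial / poch c r) / poch c (a + b) := by
  have hpos := fun j => (poch_pos hc j).ne'
  have hsub : Finset.range (a + 1) ⊆ Finset.range (m + 1) :=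
    Finset.range_subset_range.2 (by omega)
  rw [← Finset.sum_subset hsub]
  · rw [← Finset.sum_div, eq_div_iff (hpos _), add_comm a b, poch_add,
      poch_add_natCast c b a, Finset.mul_sum, Finset.mul_sum]
    refine Finset.sum_congr rfl fun r hr => ?_
    have hr' : r ≤ a := by simpa [Nat.lt_succ_iff] using hr
    have hsplit := poch_add c r (a - r)
    rw [Nat.add_sub_cancel' hr'] at hsplit
    have hq : poch (c + r) (a - r) ≠ 0 := (poch_pos (by positivity) _).ne'
    have h1 := hpos r
    have h2 := hpos b
    rw [hsplit, Nat.descFactorial_eq_factorial_mul_choose]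
    push_cast
    field_simp
  · intro r _ hr
    have : a < r := by simpa using hr
    simp [Nat.choose_eq_zero_of_lt this]

open Polynomial in
/-- The linear functional sending `X ^ p` to `(-x) ^ p / (c)_p`. -/
noncomputable def laguerreFunctional (c x : ℝ) : ℝ[X] →ₗ[ℝ] ℝ :=
  Polynomial.lsum fun p => LinearMap.mulRight ℝ ((-x) ^ p / poch c p)

open Polynomial in
theorem laguerreFunctional_X_pow (c x : ℝ) (p : ℕ) :
    laguerreFunctional c x (X ^ p) = (-x) ^ p / poch c p := by
  simp [laguerreFunctional, Polynomial.lsum_apply, ← Polynomial.monomial_one_right_eq_X_pow,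
    Polynomial.sum_monomial_index]

open Polynomial in
theorem laguerreFunctional_C_mul (c x t : ℝ) (P : ℝ[X]) :
    laguerreFunctional c x (C t * P) = t * laguerreFunctional c x P := by
  rw [← Polynomial.smul_eq_C_mul, map_smul, smul_eq_mul]

open Polynomial in
theorem laguerreFunctional_add_one_pow (c x : ℝ) (k : ℕ) :
    laguerreFunctional c x ((X + 1) ^ k)
      = ∑ p ∈ Finset.range (k + 1), (k.choose p : ℝ) * ((-x) ^ p / poch c p) := by
  rw [add_pow, map_sum]
  refine Finset.sum_congr rfl fun p _ => ?_
  rw [← laguerreFunctional_X_pow, ← laguerreFunctional_C_mul]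
  simp [mul_comm]

open Polynomial in
theorem lagL_eq_laguerreFunctional {α : ℝ} (hα : -1 < α) (k : ℕ) (x : ℝ) :
    lagL α k x
      = poch (α + 1) k / k.factorial * laguerreFunctional (α + 1) x ((X + 1) ^ k) := by
  rw [laguerreFunctional_add_one_pow, lagL, Finset.mul_sum]
  refine Finset.sum_congr rfl fun p hp => ?_
  have hp' : p ≤ k := by simpa [Nat.lt_succ_iff] using hp
  have hsplit := poch_add (α + 1) p (k - p)
  rw [Nat.add_sub_cancel' hp'] at hsplit
  have h := (poch_pos (show 0 < α + 1 by linarith) p).ne'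
  rw [hsplit, Nat.cast_choose ℝ hp', neg_pow x, show α + 1 + (p : ℝ) = α + p + 1 by ring]
  field_simp

open Polynomial in
/-- `∑ a, C(m,a) C(a,r) X ^ a = C(m,r) X ^ r (X + 1) ^ (m - r)`. -/
theorem sum_choose_mul_choose_mul_X_pow {m r : ℕ} (hr : r ≤ m) :
    ∑ a ∈ Finset.range (m + 1), C ((m.choose a : ℝ) * a.choose r) * X ^ a
      = C (m.choose r : ℝ) * (X ^ r * (X + 1) ^ (m - r)) := by
  obtain ⟨q, rfl⟩ := Nat.exists_eq_add_of_le hr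
  rw [add_assoc, Finset.sum_range_add, Finset.sum_eq_zero, zero_add, Nat.add_sub_cancel_left,
    add_pow, Finset.mul_sum, Finset.mul_sum]
  · refine Finset.sum_congr rfl fun i _ => ?_
    have h := Nat.choose_mul (n := r + q) (Nat.le_add_right r i)
    rw [Nat.add_sub_cancel_left, Nat.add_sub_cancel_left] at h
    rw [← Nat.cast_mul, h, Nat.cast_mul, C_mul, pow_add]
    simp
    ring
  · intro a ha
    simp [Nat.choose_eq_zero_of_lt (Finset.mem_range.1 ha)]

open Polynomial in
theorem laguerreFunctional_mul {c : ℝ} (hc : 0 < c) (x : ℝ) {m n : ℕ} (hmn : m ≤ n) :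
    laguerreFunctional c x ((X + 1) ^ m) * laguerreFunctional c x ((X + 1) ^ n)
      = ∑ r ∈ Finset.range (m + 1),
          (m.choose r : ℝ) * n.choose r * (r.factorial / poch c r)
            * laguerreFunctional c x (X ^ (2 * r) * (X + 1) ^ (m + n - 2 * r)) := by
  have key : ∀ r ∈ Finset.range (m + 1),
      (m.choose r : ℝ) * n.choose r * (r.factorial / poch c r)
            * laguerreFunctional c x (X ^ (2 * r) * (X + 1) ^ (m + n - 2 * r))
        = ∑ a ∈ Finset.range (m + 1), ∑ b ∈ Finset.range (n + 1),
            (m.choose a : ℝ) * a.choose r * (n.choose b * b.choose r)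
              * (r.factorial / poch c r) * ((-x) ^ (a + b) / poch c (a + b)) := by
    intro r hr
    have hr' : r ≤ m := by simpa [Nat.lt_succ_iff] using hr
    have hprod : C (m.choose r : ℝ) * (X ^ r * (X + 1) ^ (m - r))
          * (C (n.choose r : ℝ) * (X ^ r * (X + 1) ^ (n - r)))
        = C ((m.choose r : ℝ) * n.choose r) * (X ^ (2 * r) * (X + 1) ^ (m + n - 2 * r)) := by
      rw [show m + n - 2 * r = (m - r) + (n - r) by omega, C_mul]
      ring
    rw [mul_right_comm, ← laguerreFunctional_C_mul, ← hprod,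
      ← sum_choose_mul_choose_mul_X_pow hr',
      ← sum_choose_mul_choose_mul_X_pow (hr'.trans hmn), Finset.sum_mul_sum, map_sum,
      Finset.sum_mul]
    refine Finset.sum_congr rfl fun a _ => ?_
    rw [map_sum, Finset.sum_mul]
    refine Finset.sum_congr rfl fun b _ => ?_
    rw [mul_mul_mul_comm, ← C_mul, ← pow_add, laguerreFunctional_C_mul,
      laguerreFunctional_X_pow]
    ring
  rw [Finset.sum_congr rfl key, Finset.sum_comm, laguerreFunctional_add_one_pow,
    laguerreFunctional_add_one_pow, Finset.sum_mul_sum]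
  refine Finset.sum_congr rfl fun a ha => ?_
  have ha' : a ≤ m := by simpa [Nat.lt_succ_iff] using ha
  rw [Finset.sum_comm]
  refine Finset.sum_congr rfl fun b _ => ?_
  calc (m.choose a : ℝ) * ((-x) ^ a / poch c a) * (n.choose b * ((-x) ^ b / poch c b))
      = m.choose a * n.choose b * (-x) ^ (a + b) * (1 / (poch c a * poch c b)) := by
        rw [pow_add]; field_simp
    _ = _ := by
        rw [inv_poch_mul_inv_poch hc ha', Finset.mul_sum]
        refine Finset.sum_congr rfl fun r _ => ?_
        ring

open Polynomial in
/-- An iterated backward difference of `k ↦ (X + 1) ^ k`. -/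
theorem sum_neg_one_pow_choose_mul_add_one_pow {t M N : ℕ} (htM : t ≤ M) (hMN : M ≤ N) :
    ∑ s ∈ Finset.range (M + 1), C ((-1) ^ s * (t.choose s : ℝ)) * (X + 1) ^ (N - s)
      = X ^ t * (X + 1) ^ (N - t) := by
  have hsub : Finset.range (t + 1) ⊆ Finset.range (M + 1) :=
    Finset.range_subset_range.2 (by omega)
  rw [← Finset.sum_subset hsub]
  · conv_rhs => rw [show (X : ℝ[X]) = -1 + (X + 1) by ring, add_pow, Finset.sum_mul]
    refine Finset.sum_congr rfl fun s hs => ?_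
    have hs' : s ≤ t := by simpa [Nat.lt_succ_iff] using hs
    rw [show N - s = (t - s) + (N - t) by omega, pow_add]
    simp
    ring
  · intro s _ hs
    have : t < s := by simpa using hs
    simp [Nat.choose_eq_zero_of_lt this]

theorem descFactorial_div_factorial_mul {m j s : ℕ} (hj : j ≤ m) (hs : s ≤ 2 * m) :
    ((2 * m - s).descFactorial (2 * j) : ℝ) / (s.factorial * (2 * m - s).factorial)
      = ((2 * (m - j)).choose s : ℝ) / (2 * (m - j)).factorial := by
  rcases le_or_gt (2 * j) (2 * m - s) with h | h
  · rw [Nat.cast_choose ℝ (show s ≤ 2 * (m - j) by omega),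
      ← Nat.factorial_mul_descFactorial h,
      show 2 * m - s - 2 * j = 2 * (m - j) - s by omega]
    have : ((2 * m - s).descFactorial (2 * j) : ℝ) ≠ 0 := by
      rw [Ne, Nat.cast_eq_zero, Nat.descFactorial_eq_zero_iff_lt]; omega
    push_cast
    field_simp
  · rw [Nat.descFactorial_of_lt h, Nat.choose_eq_zero_of_lt (by omega)]
    simp

theorem hypSum_eq_sum {m s : ℕ} (hs : s ≤ 2 * m) (d : ℕ) (u v : ℝ) :
    hypSum [u, -((2 * m - s : ℕ) : ℝ) / 2, (-((2 * m - s : ℕ) : ℝ) + 1) / 2]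
        [(d : ℝ) + 1, v] 1
      = ∑ j ∈ Finset.range (m + 1),
          poch u j * (((2 * m - s).descFactorial (2 * j) : ℝ) / 2 ^ (2 * j))
            / (poch ((d : ℝ) + 1) j * poch v j * j.factorial) := by
  rw [hypSum, tsum_eq_sum (s := Finset.range (m + 1))]
  · refine Finset.sum_congr rfl fun j _ => ?_
    simp [poch_neg_half_mul]
  · intro j hj
    have : m < j := by simpa using hj
    simp only [List.map_cons, List.map_nil, List.prod_cons, List.prod_nil, mul_one,
      poch_neg_half_mul]
    rw [Nat.descFactorial_of_lt (by omega)]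
    simp

theorem linearization_coefficient {c : ℝ} (hc : 0 < c) (d : ℕ) {m j s : ℕ} (hj : j ≤ m)
    (hs : s ≤ 2 * m) :
    2 ^ (2 * m) * poch (1 / 2) m / (d.factorial : ℝ) / (s.factorial * (2 * m - s).factorial)
        * (poch (1 - c - m) j * (((2 * m - s).descFactorial (2 * j) : ℝ) / 2 ^ (2 * j))
            / (poch ((d : ℝ) + 1) j * poch (1 / 2 - m) j * j.factorial))
      = poch c m / ((m - j).factorial * j.factorial * (d + j).factorial * poch c (m - j))
          * ((2 * (m - j)).choose s : ℝ) := by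
  have hdesc := descFactorial_div_factorial_mul hj hs
  obtain ⟨r, rfl⟩ := Nat.exists_eq_add_of_le' hj
  rw [Nat.add_sub_cancel] at hdesc ⊢
  have hr := poch_half_mul_factorial r
  have hd := poch_natCast_add_one_mul_factorial d j
  have h1 := poch_reflect c r j
  have h2 := poch_reflect (1 / 2) r j
  rw [show (1 : ℝ) - 1 / 2 = 1 / 2 by norm_num] at h2
  have pc : poch c r ≠ 0 := (poch_pos hc r).ne'
  have ph : poch (1 / 2) r ≠ 0 := (poch_pos (by norm_num) r).ne'
  have ph' : poch (1 / 2) (r + j) ≠ 0 := (poch_pos (by norm_num) (r + j)).ne'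
  have hsign : ((-1 : ℝ) ^ j) ≠ 0 := by simp
  rw [← eq_div_iff pc] at h1
  rw [← eq_div_iff ph] at h2
  rw [← eq_div_iff (Nat.cast_ne_zero.2 (Nat.factorial_ne_zero d))] at hd
  rw [h1, h2, hd]
  rw [div_eq_div_iff (by positivity) (by positivity), ← hr] at hdesc
  have hr0 : (r.factorial : ℝ) ≠ 0 := by positivity
  have hdj : ((d + j).factorial : ℝ) ≠ 0 := by positivity
  rw [mul_add, pow_add]
  field_simp
  rw [mul_add] at hdesc
  linear_combination poch c (r + j) * hdesc

theorem stmt14 (m n : ℕ) (hmn : m ≤ n) (α : ℝ) (hα : -1 < α) (x : ℝ) :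
    lagL α m x * lagL α n x =
      2 ^ (2 * m) * poch (1 / 2) m * poch (α + 1) n / ((n - m).factorial : ℝ) *
        ∑ k ∈ Finset.Icc (n - m) (n + m),
          (-1) ^ (k + n + m) * (k.factorial : ℝ) /
              (poch (α + 1) k * ((m + n - k).factorial : ℝ) *
                ((k + m - n).factorial : ℝ)) *
            hypSum [-(m : ℝ) - α, ((n : ℝ) - m - k) / 2, ((n : ℝ) - m - k + 1) / 2]
              [(n : ℝ) - m + 1, 1 / 2 - (m : ℝ)] 1 *
            lagL α k x := by
  obtain ⟨d, rfl⟩ := Nat.exists_eq_add_of_le hmn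
  have hc : 0 < α + 1 := by linarith
  rw [lagL_eq_laguerreFunctional hα m, lagL_eq_laguerreFunctional hα (m + d), mul_mul_mul_comm,
    laguerreFunctional_mul hc x hmn]
  have hterm : ∀ s ∈ Finset.range (2 * m + 1),
      2 ^ (2 * m) * poch (1 / 2) m * poch (α + 1) (m + d) / (d.factorial : ℝ) *
        ((-1) ^ (m + (m + d) - s + (m + d) + m) * ((m + (m + d) - s).factorial : ℝ) /
              (poch (α + 1) (m + (m + d) - s) * (s.factorial : ℝ) *
                ((2 * m - s).factorial : ℝ)) *
            hypSum [-(m : ℝ) - α, -((2 * m - s : ℕ) : ℝ) / 2, (-((2 * m - s : ℕ) : ℝ) + 1) / 2]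
              [(d : ℝ) + 1, 1 / 2 - (m : ℝ)] 1 *
            lagL α (m + (m + d) - s) x)
      = ∑ j ∈ Finset.range (m + 1), poch (α + 1) (m + d) * (poch (α + 1) m /
          ((m - j).factorial * j.factorial * (d + j).factorial * poch (α + 1) (m - j))) *
          laguerreFunctional (α + 1) x (Polynomial.C ((-1) ^ s * ((2 * (m - j)).choose s : ℝ)) *
            (Polynomial.X + 1) ^ (m + (m + d) - s)) := by
    intro s hs
    have hs' : s ≤ 2 * m := by simpa [Nat.lt_succ_iff] using hs
    rw [hypSum_eq_sum hs', lagL_eq_laguerreFunctional hα, Finset.mul_sum, Finset.sum_mul,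
      Finset.mul_sum]
    refine Finset.sum_congr rfl fun j hj => ?_
    have hj' : j ≤ m := by simpa [Nat.lt_succ_iff] using hj
    have hcoef := linearization_coefficient hc d hj' hs'
    rw [show 1 - (α + 1) - (m : ℝ) = -(m : ℝ) - α by ring] at hcoef
    have hsign : (-1 : ℝ) ^ (m + (m + d) - s + (m + d) + m) = (-1) ^ s := by
      rw [show m + (m + d) - s + (m + d) + m = s + 2 * (m + (m + d) - s) by omega, pow_add,
        Even.neg_one_pow (even_two_mul _), mul_one]
    have hp := (poch_pos hc (m + (m + d) - s)).ne'
    have hf : ((m + (m + d) - s).factorial : ℝ) ≠ 0 := by positivity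
    rw [laguerreFunctional_C_mul, hsign]
    set L := laguerreFunctional (α + 1) x ((Polynomial.X + 1) ^ (m + (m + d) - s))
    calc _ = poch (α + 1) (m + d) * (2 ^ (2 * m) * poch (1 / 2) m / (d.factorial : ℝ) /
            (s.factorial * (2 * m - s).factorial) * (poch (-(m : ℝ) - α) j *
            (((2 * m - s).descFactorial (2 * j) : ℝ) / 2 ^ (2 * j)) /
            (poch ((d : ℝ) + 1) j * poch (1 / 2 - m) j * j.factorial))) * ((-1) ^ s * L) := by
          generalize poch (-(m : ℝ) - α) j * (((2 * m - s).descFactorial (2 * j) : ℝ) /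
            2 ^ (2 * j)) / (poch ((d : ℝ) + 1) j * poch (1 / 2 - m) j * j.factorial) = H
          field_simp
      _ = _ := by rw [hcoef]; ring
  have hreindex : ∀ f : ℕ → ℝ, ∑ k ∈ Finset.Icc d (m + d + m), f k
      = ∑ s ∈ Finset.range (2 * m + 1), f (m + (m + d) - s) := by
    intro f
    refine Finset.sum_nbij' (fun k => m + (m + d) - k) (fun s => m + (m + d) - s)
      ?_ ?_ ?_ ?_ ?_
    · intro k hk; simp at hk ⊢; omega
    · intro s hs; simp at hs ⊢; omega
    · intro k hk; simp at hk ⊢; omega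
    · intro s hs; simp at hs ⊢; omega
    · intro k hk
      simp at hk
      rw [show m + (m + d) - (m + (m + d) - k) = k by omega]
  rw [Nat.add_sub_cancel_left, hreindex]
  trans ∑ s ∈ Finset.range (2 * m + 1), ∑ j ∈ Finset.range (m + 1),
      poch (α + 1) (m + d) * (poch (α + 1) m /
          ((m - j).factorial * j.factorial * (d + j).factorial * poch (α + 1) (m - j))) *
          laguerreFunctional (α + 1) x (Polynomial.C ((-1) ^ s * ((2 * (m - j)).choose s : ℝ)) *
            (Polynomial.X + 1) ^ (m + (m + d) - s))
  · rw [Finset.sum_comm, Finset.mul_sum, ← Finset.sum_range_reflect]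
    refine Finset.sum_congr rfl fun j hj => ?_
    have hj' : j ≤ m := by simpa [Nat.lt_succ_iff] using hj
    rw [← Finset.mul_sum, ← map_sum,
      sum_neg_one_pow_choose_mul_add_one_pow (by omega) (by omega), Nat.add_sub_cancel,
      Nat.cast_choose ℝ (Nat.sub_le m j), Nat.cast_choose ℝ (show m - j ≤ m + d by omega),
      show m + d - (m - j) = d + j by omega, Nat.sub_sub_self hj']
    have hp := (poch_pos hc (m - j)).ne'
    field_simp
  · rw [Finset.mul_sum]
    refine Finset.sum_congr rfl fun s hs => ?_
    have hs' : s ≤ 2 * m := by simpa [Nat.lt_succ_iff] using hs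
    rw [← hterm s hs, show m + (m + d) - (m + (m + d) - s) = s by omega,
      show m + (m + d) - s + m - (m + d) = 2 * m - s by omega]
    have e : ((m + d : ℕ) : ℝ) - m - ((m + (m + d) - s : ℕ) : ℝ) = -((2 * m - s : ℕ) : ℝ) := by
      rw [Nat.cast_sub hs', Nat.cast_sub (by omega)]
      push_cast
      ring
    rw [e, show ((m + d : ℕ) : ℝ) - m + 1 = d + 1 by push_cast; ring]
end

section
/- Let p, m, n ∈ ℕ and let α ∈ ℝ with α > −1. Define 𝖫(p,m,n;α) := ∫_{0}^{∞} L_p^α(x)·L_m^α(x)·L_n^α(x)·x^α e^{−x} dx, with the convention L_{−1}^α := 0. Then the following three contiguous relations hold: (i) (p+1)·𝖫(p+1,m,n;α) − (m+1)·𝖫(p,m+1,n;α) = (m+α)·𝖫(p,m−1,n;α) − (p+α)·𝖫(p−1,m,n;α) + 2(p−m)·𝖫(p,m,n;α); (ii) (p+1)·𝖫(p+1,m,n;α) − (n+1)·𝖫(p,m,n+1;α) = (n+α)·𝖫(p,m,n−1;α) − (p+α)·𝖫(p−1,m,n;α) + 2(p−n)·𝖫(p,m,n;α); (iii) (m+1)·𝖫(p,m+1,n;α)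 − (n+1)·𝖫(p,m,n+1;α) = (n+α)·𝖫(p,m,n−1;α) − (m+α)·𝖫(p,m−1,n;α) + 2(m−n)·𝖫(p,m,n;α). -/
open MeasureTheory

/-- Laguerre polynomial with integer index, convention `L_{-1}^α := 0` (indeed `0` for all
negative indices). -/
noncomputable def lagLZ (α : ℝ) (n : ℤ) (x : ℝ) : ℝ :=
  if 0 ≤ n then lagL α n.toNat x else 0

/-- The integral `𝖫(p,m,n;α)` of a product of three Laguerre polynomials against
`x^α e^{-x}` on `(0,∞)`. -/
noncomputable def Lint3 (α : ℝ) (p m n : ℤ) : ℝ :=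
  ∫ x in Set.Ioi (0 : ℝ),
    lagLZ α p x * lagLZ α m x * lagLZ α n x * x ^ α * Real.exp (-x)

/-- The coefficient of `x ^ k` in `lagL α n x`, extended by zero to `n < k`. -/
noncomputable def lagCoeff (α : ℝ) (n k : ℕ) : ℝ :=
  if k ≤ n then
    (-1) ^ k * poch (α + k + 1) (n - k) / (((n - k).factorial : ℝ) * k.factorial)
  else 0

theorem lagCoeff_add (α : ℝ) (k j : ℕ) :
    lagCoeff α (k + j) k =
      (-1) ^ k * poch (α + k + 1) j / ((j.factorial : ℝ) * k.factorial) := by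
  simp [lagCoeff]

theorem lagCoeff_of_lt (α : ℝ) {n k : ℕ} (h : n < k) : lagCoeff α n k = 0 :=
  if_neg h.not_ge

theorem lagL_eq_sum_lagCoeff (α x : ℝ) {n N : ℕ} (h : n < N) :
    lagL α n x = ∑ k ∈ Finset.range N, lagCoeff α n k * x ^ k := by
  have hs : Finset.range (n + 1) ⊆ Finset.range N := Finset.range_mono h
  rw [lagL, ← Finset.sum_subset hs]
  · refine Finset.sum_congr rfl fun k hk => ?_
    rw [lagCoeff, if_pos (Nat.lt_succ_iff.1 (Finset.mem_range.1 hk))]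
  · intro k _ hk
    rw [lagCoeff_of_lt α (by rw [Finset.mem_range] at hk; omega), zero_mul]

theorem lagCoeff_recurrence_zero (α : ℝ) (n : ℕ) :
    ((n : ℝ) + 2) * lagCoeff α (n + 2) 0 + ((n : ℝ) + 1 + α) * lagCoeff α n 0 =
      (2 * n + 3 + α) * lagCoeff α (n + 1) 0 := by
  simp only [lagCoeff, Nat.zero_le, if_true, Nat.sub_zero, poch_succ, Nat.factorial_succ]
  have := Nat.factorial_pos n
  push_cast
  field_simp
  ring

theorem lagCoeff_recurrence_succ (α : ℝ) (n k : ℕ) :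
    ((n : ℝ) + 2) * lagCoeff α (n + 2) (k + 1) + ((n : ℝ) + 1 + α) * lagCoeff α n (k + 1) =
      (2 * n + 3 + α) * lagCoeff α (n + 1) (k + 1) - lagCoeff α (n + 1) k := by
  have hk := Nat.factorial_pos k
  rcases lt_trichotomy k n with h | rfl | h
  · obtain ⟨j, rfl⟩ := Nat.exists_eq_add_of_lt h
    have hj := Nat.factorial_pos j
    rw [show k + j + 1 + 2 = (k + 1) + (j + 2) by ring, lagCoeff_add,
      show k + j + 1 = (k + 1) + j by ring, lagCoeff_add,
      show k + 1 + j + 1 = (k + 1) + (j + 1) by ring, lagCoeff_add,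
      show k + 1 + (j + 1) = k + (j + 2) by ring, lagCoeff_add,
      poch_succ_left (α + k + 1) (j + 1)]
    push_cast
    rw [← add_assoc α (k : ℝ) 1]
    simp only [poch_succ, Nat.factorial_succ]
    push_cast
    field_simp
    ring
  · rw [lagCoeff_of_lt α (Nat.lt_succ_self k), show k + 2 = (k + 1) + 1 by ring,
      lagCoeff_add, lagCoeff_add α k 1, show lagCoeff α (k + 1) (k + 1) = _ from
        lagCoeff_add α (k + 1) 0]
    simp only [poch_succ, poch_zero, Nat.factorial_succ, Nat.factorial_zero]
    push_cast
    field_simp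
    ring
  · rw [lagCoeff_of_lt α (by omega : n < k + 1), lagCoeff_of_lt α (by omega : n + 1 < k + 1)]
    rcases (Nat.succ_le_of_lt h).eq_or_lt with rfl | h'
    · rw [show lagCoeff α (n + 2) (n.succ + 1) = _ from lagCoeff_add α (n + 2) 0,
        show lagCoeff α (n + 1) n.succ = _ from lagCoeff_add α (n + 1) 0]
      simp only [poch_zero, Nat.factorial_succ, Nat.factorial_zero]
      have := Nat.factorial_pos n
      push_cast
      field_simp
      ring
    · rw [lagCoeff_of_lt α (by omega : n + 2 < k + 1), lagCoeff_of_lt α (by omega : n + 1 < k)]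
      ring

theorem lagL_recurrence (α x : ℝ) (n : ℕ) :
    ((n : ℝ) + 2) * lagL α (n + 2) x + ((n : ℝ) + 1 + α) * lagL α n x =
      (2 * n + 3 + α - x) * lagL α (n + 1) x := by
  have hx : x * lagL α (n + 1) x =
      ∑ k ∈ Finset.range (n + 2), lagCoeff α (n + 1) k * x ^ (k + 1) := by
    rw [lagL_eq_sum_lagCoeff α x (Nat.lt_succ_self (n + 1)), Finset.mul_sum]
    exact Finset.sum_congr rfl fun k _ => by ring
  rw [sub_mul, hx, lagL_eq_sum_lagCoeff α x (by omega : n + 2 < n + 2 + 1),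
    lagL_eq_sum_lagCoeff α x (by omega : n < n + 2 + 1),
    lagL_eq_sum_lagCoeff α x (by omega : n + 1 < n + 2 + 1)]
  simp only [Finset.sum_range_succ' _ (n + 2), mul_add, Finset.mul_sum]
  have hs : ∑ k ∈ Finset.range (n + 2),
        ((n : ℝ) + 2) * (lagCoeff α (n + 2) (k + 1) * x ^ (k + 1)) +
      ∑ k ∈ Finset.range (n + 2),
        ((n : ℝ) + 1 + α) * (lagCoeff α n (k + 1) * x ^ (k + 1)) =
      ∑ k ∈ Finset.range (n + 2),
        (2 * n + 3 + α) * (lagCoeff α (n + 1) (k + 1) * x ^ (k + 1)) -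
      ∑ k ∈ Finset.range (n + 2), lagCoeff α (n + 1) k * x ^ (k + 1) := by
    rw [← Finset.sum_add_distrib, ← Finset.sum_sub_distrib]
    refine Finset.sum_congr rfl fun k _ => ?_
    linear_combination x ^ (k + 1) * lagCoeff_recurrence_succ α n k
  linear_combination hs + x ^ 0 * lagCoeff_recurrence_zero α n

theorem lagLZ_recurrence (α x : ℝ) (n : ℕ) :
    ((n : ℝ) + 1) * lagLZ α ((n : ℤ) + 1) x + ((n : ℝ) + α) * lagLZ α ((n : ℤ) - 1) x =
      (2 * n + 1 + α - x) * lagLZ α n x := by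
  cases n with
  | zero =>
    simp [lagLZ, lagL, Finset.sum_range_succ, poch_zero, poch_succ]
    ring
  | succ n =>
    have h₂ : lagLZ α (((n + 1 : ℕ) : ℤ) + 1) x = lagL α (n + 2) x := if_pos (by omega)
    have h₁ : lagLZ α ((n + 1 : ℕ) : ℤ) x = lagL α (n + 1) x := if_pos (by omega)
    have h₀ : lagLZ α (((n + 1 : ℕ) : ℤ) - 1) x = lagL α n x := by simp [lagLZ]
    rw [h₂, h₁, h₀]
    push_cast
    linear_combination lagL_recurrence α x n

theorem exists_polynomial_lagLZ (α : ℝ) (n : ℤ) :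
    ∃ P : Polynomial ℝ, ∀ x, lagLZ α n x = P.eval x := by
  by_cases h : 0 ≤ n
  · refine ⟨∑ k ∈ Finset.range (n.toNat + 1),
      Polynomial.monomial k (lagCoeff α n.toNat k), fun x => ?_⟩
    rw [lagLZ, if_pos h, lagL_eq_sum_lagCoeff α x (Nat.lt_succ_self _),
      Polynomial.eval_finsetSum]
    simp
  · exact ⟨0, fun x => by simp [lagLZ, h]⟩

theorem integrableOn_polynomial_mul_rpow_mul_exp_neg {α : ℝ} (hα : -1 < α)
    (P : Polynomial ℝ) :
    IntegrableOn (fun x => P.eval x * x ^ α * Real.exp (-x)) (Set.Ioi 0) := by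
  induction P using Polynomial.induction_on' with
  | add P Q hP hQ =>
    refine (hP.add hQ).congr_fun (fun x _ => ?_) measurableSet_Ioi
    simp only [Pi.add_apply, Polynomial.eval_add]
    ring
  | monomial k a =>
    have hk : 0 < (k : ℝ) + α + 1 := by
      have := k.cast_nonneg (α := ℝ)
      linarith
    refine IntegrableOn.congr_fun ((Real.GammaIntegral_convergent hk).const_mul a)
      (fun x hx => ?_) measurableSet_Ioi
    simp only [Polynomial.eval_monomial, add_sub_cancel_right]
    rw [Real.rpow_add hx, Real.rpow_natCast]
    ring

theorem integrableOn_lagLZ_mul {α : ℝ} (hα : -1 < α) (p m n : ℤ) :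
    IntegrableOn (fun x => lagLZ α p x * lagLZ α m x * lagLZ α n x * x ^ α * Real.exp (-x))
      (Set.Ioi 0) := by
  obtain ⟨P, hP⟩ := exists_polynomial_lagLZ α p
  obtain ⟨Q, hQ⟩ := exists_polynomial_lagLZ α m
  obtain ⟨R, hR⟩ := exists_polynomial_lagLZ α n
  simpa [hP, hQ, hR] using integrableOn_polynomial_mul_rpow_mul_exp_neg hα (P * Q * R)

theorem Lint3_swap_left (α : ℝ) (p m n : ℤ) : Lint3 α p m n = Lint3 α m p n := by
  simp only [Lint3, mul_comm (lagLZ α p _)]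

theorem Lint3_swap_right (α : ℝ) (p m n : ℤ) : Lint3 α p m n = Lint3 α p n m := by
  simp only [Lint3, mul_right_comm (lagLZ α p _)]

theorem Lint3_contiguous {α : ℝ} (hα : -1 < α) (p m : ℕ) (n : ℤ) :
    ((p : ℝ) + 1) * Lint3 α ((p : ℤ) + 1) m n - ((m : ℝ) + 1) * Lint3 α p ((m : ℤ) + 1) n
      = ((m : ℝ) + α) * Lint3 α p ((m : ℤ) - 1) n
        - ((p : ℝ) + α) * Lint3 α ((p : ℤ) - 1) m n
        + 2 * ((p : ℝ) - m) * Lint3 α p m n := by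
  have hI := fun (c : ℝ) (a b : ℤ) => (integrableOn_lagLZ_mul hα a b n).const_mul c
  simp only [Lint3, ← integral_const_mul]
  rw [← integral_sub (hI _ _ _) (hI _ _ _), ← integral_sub (hI _ _ _) (hI _ _ _),
    ← integral_add ?_ (hI _ _ _)]
  swap
  · exact (hI _ _ _).sub (hI _ _ _)
  refine integral_congr_ae (Filter.Eventually.of_forall fun x => ?_)
  linear_combination
    lagLZ α n x * x ^ α * Real.exp (-x) *
      (lagLZ α m x * lagLZ_recurrence α x p - lagLZ α p x * lagLZ_recurrence α x m)

theorem stmt16 (p m n : ℕ) (α : ℝ) (hα : -1 < α) :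
    (((p : ℝ) + 1) * Lint3 α ((p : ℤ) + 1) m n - ((m : ℝ) + 1) * Lint3 α p ((m : ℤ) + 1) n
      = ((m : ℝ) + α) * Lint3 α p ((m : ℤ) - 1) n
        - ((p : ℝ) + α) * Lint3 α ((p : ℤ) - 1) m n
        + 2 * ((p : ℝ) - m) * Lint3 α p m n) ∧
    (((p : ℝ) + 1) * Lint3 α ((p : ℤ) + 1) m n - ((n : ℝ) + 1) * Lint3 α p m ((n : ℤ) + 1)
      = ((n : ℝ) + α) * Lint3 α p m ((n : ℤ) - 1)
        - ((p : ℝ) + α) * Lint3 α ((p : ℤ) - 1) m n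
        + 2 * ((p : ℝ) - n) * Lint3 α p m n) ∧
    (((m : ℝ) + 1) * Lint3 α p ((m : ℤ) + 1) n - ((n : ℝ) + 1) * Lint3 α p m ((n : ℤ) + 1)
      = ((n : ℝ) + α) * Lint3 α p m ((n : ℤ) - 1)
        - ((m : ℝ) + α) * Lint3 α p ((m : ℤ) - 1) n
        + 2 * ((m : ℝ) - n) * Lint3 α p m n) := by
  refine ⟨Lint3_contiguous hα p m n, ?_, ?_⟩
  · simpa only [Lint3_swap_right α _ _ (m : ℤ)] using Lint3_contiguous hα p n m
  · simpa only [Lint3_swap_left α _ (p : ℤ), Lint3_swap_right α _ _ (p : ℤ)] using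
      Lint3_contiguous hα m n p
end
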